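/- Let Ω ⊂ ℝⁿ be a bounded strictly convex open domain with smooth boundary and diameter D = diam(Ω), and let V : Ω̄ → ℝ be a smooth convex potential. Let φ₀ be the ground state of L = −Δ + V with Dirichlet boundary condition on Ω. Then for all x, y ∈ Ω with x ≠ y, ⟨∇log φ₀(x) − ∇log φ₀(y), (x − y)/|x − y|⟩ ≤ −(2π/D)·tan(π|x − y|/(2D)). -/

import Mathlib

open Metric Set
open scoped RealInnerProductSpace

/-- The Laplacian of a function on Euclidean space, `Δ f x = ∑ i ∂²f/∂xᵢ²`. -/
noncomputable def lap {n : ℕ} (f : EuclideanSpace ℝ (Fin n) → ℝ)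
    (x : EuclideanSpace ℝ (Fin n)) : ℝ :=
  ∑ i : Fin n, fderiv ℝ (fun y => fderiv ℝ f y (EuclideanSpace.single i 1)) x
    (EuclideanSpace.single i 1)


section Calculus

variable {E : Type*} [NormedAddCommGroup E] [NormedSpace ℝ E]

/-- The second derivative test: at a local maximum the second derivative is nonpositive. -/
lemma second_deriv_nonpos_of_isLocalMax {f f' : ℝ → ℝ} {c : ℝ} (h : IsLocalMax f 0)
    (h1 : ∀ᶠ t in nhds 0, HasDerivAt f (f' t) t) (h2 : HasDerivAt f' c 0) : c ≤ 0 := by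
  by_contra! hc
  have hd : deriv f =ᶠ[nhds 0] f' := h1.mono fun t ht => ht.deriv
  have h0 : deriv f 0 = 0 := h.deriv_eq_zero
  have h2' : deriv (deriv f) 0 = c := by rw [hd.deriv_eq, h2.deriv]
  have hmin : IsLocalMin f 0 :=
    isLocalMin_of_deriv_deriv_pos (by rw [h2']; exact hc) h0 h1.self_of_nhds.continuousAt
  have hconst : f =ᶠ[nhds 0] fun _ => f 0 := by
    filter_upwards [h, hmin] with t ht ht'
    exact le_antisymm ht ht'
  have hd0 : deriv f =ᶠ[nhds 0] fun _ => 0 := by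
    filter_upwards [hconst.eventuallyEq_nhds] with t ht
    rw [ht.deriv_eq]; simp
  rw [hd0.deriv_eq] at h2'
  simp at h2'
  linarith

lemma hasDerivAt_comp_line {k : E → ℝ} {x a : E} {t : ℝ}
    (hk : DifferentiableAt ℝ k (x + t • a)) :
    HasDerivAt (fun s : ℝ => k (x + s • a)) (fderiv ℝ k (x + t • a) a) t := by
  have h : HasDerivAt (fun s : ℝ => x + s • a) a t := by
    simpa using ((hasDerivAt_id t).smul_const a).const_add x
  exact hk.hasFDerivAt.comp_hasDerivAt t h

lemma differentiableAt_fderiv {F : Type*} [NormedAddCommGroup F] [NormedSpace ℝ F]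
    {k : E → F} {x : E} (hk : ContDiffAt ℝ 2 k x) :
    DifferentiableAt ℝ (fderiv ℝ k) x :=
  (hk.fderiv_right (m := 1) (by norm_num)).differentiableAt (by norm_num)

lemma fderiv_fderiv_apply {k : E → ℝ} {x : E} (hk : ContDiffAt ℝ 2 k x) (a b : E) :
    fderiv ℝ (fun y => fderiv ℝ k y a) x b = fderiv ℝ (fderiv ℝ k) x b a := by
  rw [fderiv_clm_apply (differentiableAt_fderiv hk) (differentiableAt_const a)]
  simp

lemma hasDerivAt_fderiv_comp_line {k : E → ℝ} {x a : E} {t : ℝ}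
    (hk : ContDiffAt ℝ 2 k (x + t • a)) :
    HasDerivAt (fun s : ℝ => fderiv ℝ k (x + s • a) a)
      (fderiv ℝ (fderiv ℝ k) (x + t • a) a a) t := by
  have h := hasDerivAt_comp_line (k := fun y => fderiv ℝ k y a) (x := x) (a := a) (t := t)
    ((differentiableAt_fderiv hk).clm_apply (differentiableAt_const a))
  rwa [fderiv_fderiv_apply hk] at h

lemma eventually_contDiffAt_line {k : E → ℝ} {x : E} (hk : ContDiffAt ℝ 2 k x) (a : E) :
    ∀ᶠ t : ℝ in nhds 0, ContDiffAt ℝ 2 k (x + t • a) := by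
  have h : Filter.Tendsto (fun t : ℝ => x + t • a) (nhds 0) (nhds x) := by
    have : Continuous fun t : ℝ => x + t • a := by fun_prop
    simpa using this.tendsto 0
  exact h.eventually (hk.eventually (by norm_num))

end Calculus

lemma lap_eq_sum_orthonormalBasis {n : ℕ} {ι : Type*} [Fintype ι]
    (b : OrthonormalBasis ι ℝ (EuclideanSpace ℝ (Fin n)))
    {f : EuclideanSpace ℝ (Fin n) → ℝ} {x : EuclideanSpace ℝ (Fin n)}
    (hf : ContDiffAt ℝ 2 f x) :
    lap f x = ∑ i, fderiv ℝ (fderiv ℝ f) x (b i) (b i) := by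
  have h1 := congrFun
    (InnerProductSpace.laplacian_eq_iteratedFDeriv_orthonormalBasis f b) x
  have h2 := congrFun
    (InnerProductSpace.laplacian_eq_iteratedFDeriv_orthonormalBasis f
      (EuclideanSpace.basisFun (Fin n) ℝ)) x
  simp only [iteratedFDeriv_two_apply] at h1 h2
  rw [h1] at h2
  simp only [lap]
  rw [Finset.sum_congr rfl fun _ _ => fderiv_fderiv_apply hf _ _]
  simpa using h2.symm

lemma lap_eq_sum_fderiv_fderiv {n : ℕ}
    {f : EuclideanSpace ℝ (Fin n) → ℝ} {x : EuclideanSpace ℝ (Fin n)}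
    (hf : ContDiffAt ℝ 2 f x) :
    lap f x = ∑ i, fderiv ℝ (fderiv ℝ f) x (EuclideanSpace.single i 1)
      (EuclideanSpace.single i 1) :=
  Finset.sum_congr rfl fun _ _ => fderiv_fderiv_apply hf _ _

section TwoPointMaximumPrinciple

variable {n : ℕ}

/-- The component of `∇v x - ∇v y` in the direction of `x - y`. -/
noncomputable def gradGap (v : EuclideanSpace ℝ (Fin n) → ℝ) (x y : EuclideanSpace ℝ (Fin n)) : ℝ :=
  (fderiv ℝ v x (x - y) - fderiv ℝ v y (x - y)) / ‖x - y‖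

lemma inner_gradient {v : EuclideanSpace ℝ (Fin n) → ℝ} (x a : EuclideanSpace ℝ (Fin n)) :
    ⟪gradient v x, a⟫ = fderiv ℝ v x a := by
  simp [gradient]

lemma gradGap_eq_inner (v : EuclideanSpace ℝ (Fin n) → ℝ) (x y : EuclideanSpace ℝ (Fin n)) :
    ⟪gradient v x - gradient v y, (‖x - y‖)⁻¹ • (x - y)⟫ = gradGap v x y := by
  rw [inner_sub_left, inner_smul_right, inner_smul_right, inner_gradient, inner_gradient, gradGap]
  ring

/-- The image of the standard basis under the reflection in the hyperplane `eᗮ`. -/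
lemma exists_reflected_basis {e : EuclideanSpace ℝ (Fin n)} (he : ‖e‖ = 1) :
    ∃ b : OrthonormalBasis (Fin n) ℝ (EuclideanSpace ℝ (Fin n)),
      ∀ i, b i = EuclideanSpace.single i 1 - (2 * ⟪e, EuclideanSpace.single i 1⟫) • e := by
  refine ⟨(EuclideanSpace.basisFun (Fin n) ℝ).map (ℝ ∙ e)ᗮ.reflection, fun i => ?_⟩
  simp only [OrthonormalBasis.map_apply, EuclideanSpace.basisFun_apply]
  rw [Submodule.reflection_orthogonal_apply, Submodule.reflection_singleton_apply]
  simp only [he, mul_smul]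
  simp [two_smul]

lemma reflected_path_norm {x y a : EuclideanSpace ℝ (Fin n)} {r : ℝ}
    {e : EuclideanSpace ℝ (Fin n)} (he : ‖e‖ = 1) (hxy : x - y = r • e) {t : ℝ}
    (ht : 0 < r + 2 * t * ⟪e, a⟫) :
    (x + t • a) - (y + t • (a - (2 * ⟪e, a⟫) • e)) = (r + 2 * t * ⟪e, a⟫) • e ∧
    ‖(x + t • a) - (y + t • (a - (2 * ⟪e, a⟫) • e))‖ = r + 2 * t * ⟪e, a⟫ := by
  have h : (x + t • a) - (y + t • (a - (2 * ⟪e, a⟫) • e)) = (r + 2 * t * ⟪e, a⟫) • e := by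
    have : x = y + r • e := by rw [← hxy]; abel
    rw [this]
    module
  refine ⟨h, ?_⟩
  rw [h, norm_smul, he, Real.norm_of_nonneg ht.le, mul_one]

lemma contDiffAt_fderiv_apply {v : EuclideanSpace ℝ (Fin n) → ℝ} {x : EuclideanSpace ℝ (Fin n)}
    (hv : ContDiffAt ℝ 3 v x) (e : EuclideanSpace ℝ (Fin n)) :
    ContDiffAt ℝ 2 (fun z => fderiv ℝ v z e) x :=
  (hv.fderiv_right (m := 2) (by norm_num)).clm_apply contDiffAt_const

/-- Second variation of the two-point function along a pair of directions exchanged by the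
reflection in `(x - y)ᗮ`. -/
lemma second_variation_nonpos {v G : EuclideanSpace ℝ (Fin n) → ℝ} {ψ ψ' : ℝ → ℝ} {ψ'' ε r : ℝ}
    {x y e : EuclideanSpace ℝ (Fin n)} (hr : 0 < r) (he : ‖e‖ = 1) (hxy : x - y = r • e)
    (hvx : ContDiffAt ℝ 3 v x) (hvy : ContDiffAt ℝ 3 v y)
    (hGx : ContDiffAt ℝ 2 G x) (hGy : ContDiffAt ℝ 2 G y)
    (hψ : ∀ᶠ s in nhds (r / 2), HasDerivAt ψ (ψ' s) s) (hψ' : HasDerivAt ψ' ψ'' (r / 2))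
    (hmax : IsLocalMax (fun p : EuclideanSpace ℝ (Fin n) × EuclideanSpace ℝ (Fin n) =>
      gradGap v p.1 p.2 - 2 * ψ (‖p.1 - p.2‖ / 2) - ε * (G p.1 + G p.2)) (x, y))
    (a b : EuclideanSpace ℝ (Fin n)) (hb : b = a - (2 * ⟪e, a⟫) • e) :
    fderiv ℝ (fderiv ℝ fun z => fderiv ℝ v z e) x a a
      - fderiv ℝ (fderiv ℝ fun z => fderiv ℝ v z e) y b b - 2 * ψ'' * ⟪e, a⟫ ^ 2
      - ε * (fderiv ℝ (fderiv ℝ G) x a a + fderiv ℝ (fderiv ℝ G) y b b) ≤ 0 := by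
  set k : EuclideanSpace ℝ (Fin n) → ℝ := fun z => fderiv ℝ v z e with hk
  set c := ⟪e, a⟫ with hc
  have hkx : ContDiffAt ℝ 2 k x := contDiffAt_fderiv_apply hvx e
  have hky : ContDiffAt ℝ 2 k y := contDiffAt_fderiv_apply hvy e
  have hpath : Filter.Tendsto (fun t : ℝ => (x + t • a, y + t • b)) (nhds 0) (nhds (x, y)) := by
    have : Continuous fun t : ℝ => (x + t • a, y + t • b) := by fun_prop
    simpa using this.tendsto 0
  have hpos : ∀ᶠ t : ℝ in nhds 0, 0 < r + 2 * t * c := by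
    have : Continuous fun t : ℝ => r + 2 * t * c := by fun_prop
    exact (this.tendsto 0).eventually (lt_mem_nhds (by simpa using hr))
  have hlin : ∀ t : ℝ, HasDerivAt (fun t : ℝ => r / 2 + t * c) c t := fun t => by
    simpa using ((hasDerivAt_id t).mul_const c).const_add (r / 2)
  have hψt : ∀ᶠ t : ℝ in nhds 0, HasDerivAt ψ (ψ' (r / 2 + t * c)) (r / 2 + t * c) := by
    have : Filter.Tendsto (fun t : ℝ => r / 2 + t * c) (nhds 0) (nhds (r / 2)) := by
      simpa using (hlin 0).continuousAt.tendsto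
    exact this.eventually hψ
  have heq : ∀ t : ℝ, 0 < r + 2 * t * c →
      gradGap v (x + t • a) (y + t • b) - 2 * ψ (‖(x + t • a) - (y + t • b)‖ / 2)
        - ε * (G (x + t • a) + G (y + t • b))
      = k (x + t • a) - k (y + t • b) - 2 * ψ (r / 2 + t * c)
        - ε * (G (x + t • a) + G (y + t • b)) := by
    intro t ht
    obtain ⟨h1, h2⟩ := reflected_path_norm (a := a) he hxy ht
    simp only [← hc] at h1 h2
    rw [gradGap, hb, h2, h1]
    simp only [map_smul, smul_eq_mul, hk]
    rw [show (r + 2 * t * c) / 2 = r / 2 + t * c by ring]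
    congr 2
    field_simp
  have hmax' : IsLocalMax (fun t : ℝ => k (x + t • a) - k (y + t • b) - 2 * ψ (r / 2 + t * c)
        - ε * (G (x + t • a) + G (y + t • b))) 0 := by
    have h0 := heq 0 (by simpa using hr)
    filter_upwards [hpath.eventually hmax, hpos] with t ht htp
    rw [← heq t htp, ← h0]
    simpa using ht
  refine second_deriv_nonpos_of_isLocalMax hmax' (f' := fun t =>
    fderiv ℝ k (x + t • a) a - fderiv ℝ k (y + t • b) b - 2 * (ψ' (r / 2 + t * c) * c)
      - ε * (fderiv ℝ G (x + t • a) a + fderiv ℝ G (y + t • b) b)) ?_ ?_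
  · filter_upwards [hψt, eventually_contDiffAt_line hkx a, eventually_contDiffAt_line hky b,
      eventually_contDiffAt_line hGx a, eventually_contDiffAt_line hGy b] with t h1 h2 h3 h4 h5
    have hd : ∀ {f : EuclideanSpace ℝ (Fin n) → ℝ} {z}, ContDiffAt ℝ 2 f z →
      DifferentiableAt ℝ f z := fun h => h.differentiableAt (by norm_num)
    exact (((hasDerivAt_comp_line (hd h2)).sub (hasDerivAt_comp_line (hd h3))).sub
      ((h1.comp t (hlin t)).const_mul 2)).sub
      (((hasDerivAt_comp_line (hd h4)).add (hasDerivAt_comp_line (hd h5))).const_mul ε)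
  · have e0 : ∀ {f : EuclideanSpace ℝ (Fin n) → ℝ} {z w}, ContDiffAt ℝ 2 f z →
        HasDerivAt (fun t : ℝ => fderiv ℝ f (z + t • w) w) (fderiv ℝ (fderiv ℝ f) z w w) 0 := by
      intro f z w h
      simpa using hasDerivAt_fderiv_comp_line (k := f) (x := z) (a := w) (t := 0) (by simpa using h)
    have hψ0 : HasDerivAt (fun t : ℝ => ψ' (r / 2 + t * c)) (ψ'' * c) 0 :=
      HasDerivAt.comp (h₂ := ψ') (h := fun t : ℝ => r / 2 + t * c) (0 : ℝ)
        (by simpa using hψ') (hlin 0)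
    exact ((((e0 hkx (w := a)).sub (e0 hky (w := b))).sub
      ((hψ0.mul_const c).const_mul 2)).sub
      (((e0 hGx (w := a)).add (e0 hGy (w := b))).const_mul ε)).congr_deriv (by ring)

/-- First variation of the two-point function along the flow of `∇v`. -/
lemma first_variation {v G : EuclideanSpace ℝ (Fin n) → ℝ} {ψ : ℝ → ℝ} {ψ' ε r : ℝ}
    {x y e : EuclideanSpace ℝ (Fin n)} (hr : 0 < r) (he : ‖e‖ = 1) (hxy : x - y = r • e)
    (hvx : ContDiffAt ℝ 2 v x) (hvy : ContDiffAt ℝ 2 v y)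
    (hGx : DifferentiableAt ℝ G x) (hGy : DifferentiableAt ℝ G y)
    (hψ : HasDerivAt ψ ψ' (r / 2))
    (hmax : IsLocalMax (fun p : EuclideanSpace ℝ (Fin n) × EuclideanSpace ℝ (Fin n) =>
      gradGap v p.1 p.2 - 2 * ψ (‖p.1 - p.2‖ / 2) - ε * (G p.1 + G p.2)) (x, y)) :
    fderiv ℝ (fun z => fderiv ℝ v z e) x (gradient v x)
      - fderiv ℝ (fun z => fderiv ℝ v z e) y (gradient v y) - ψ' * gradGap v x y
      - ε * (fderiv ℝ G x (gradient v x) + fderiv ℝ G y (gradient v y)) ≤ 0 := by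
  set X := gradient v x with hX
  set Y := gradient v y with hY
  have hpath : Filter.Tendsto (fun t : ℝ => (x + t • X, y + t • Y)) (nhds 0) (nhds (x, y)) := by
    have : Continuous fun t : ℝ => (x + t • X, y + t • Y) := by fun_prop
    simpa using this.tendsto 0
  have hlin : ∀ {z Z : EuclideanSpace ℝ (Fin n)}, HasDerivAt (fun t : ℝ => z + t • Z) Z 0 := by
    intro z Z
    simpa using ((hasDerivAt_id (0 : ℝ)).smul_const Z).const_add z
  have hz : HasDerivAt (fun t : ℝ => (x + t • X) - (y + t • Y)) (X - Y) 0 := hlin.sub hlin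
  have hnorm : ‖x - y‖ = r := by rw [hxy, norm_smul, he, Real.norm_of_nonneg hr.le, mul_one]
  have hN : HasDerivAt (fun t : ℝ => ‖(x + t • X) - (y + t • Y)‖) ⟪e, X - Y⟫ 0 := by
    have h := hz.norm_sq.sqrt (by simp [hnorm, hr.ne'])
    simp only [Real.sqrt_sq (norm_nonneg _)] at h
    convert h using 1
    simp only [zero_smul, add_zero, hnorm]
    rw [hxy, inner_smul_left]
    simp
    field_simp
  have hDv : ∀ {z Z : EuclideanSpace ℝ (Fin n)}, ContDiffAt ℝ 2 v z →
      HasDerivAt (fun t : ℝ => fderiv ℝ v (z + t • Z)) (fderiv ℝ (fderiv ℝ v) z Z) 0 := by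
    intro z Z h
    exact HasFDerivAt.comp_hasDerivAt (0 : ℝ)
      (by simpa using (differentiableAt_fderiv h).hasFDerivAt) hlin
  have hnum := ((hDv (Z := X) hvx).clm_apply hz).sub ((hDv (Z := Y) hvy).clm_apply hz)
  have hgap := hnum.div hN (by simp [hnorm, hr.ne'])
  have hψt : HasDerivAt (fun t : ℝ => ψ (‖(x + t • X) - (y + t • Y)‖ / 2))
      (ψ' * (⟪e, X - Y⟫ / 2)) 0 :=
    HasDerivAt.comp (h₂ := ψ) (h := fun t : ℝ => ‖(x + t • X) - (y + t • Y)‖ / 2) (0 : ℝ)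
      (by simpa [hnorm] using hψ) (hN.div_const 2)
  have hG : ∀ {z Z : EuclideanSpace ℝ (Fin n)}, DifferentiableAt ℝ G z →
      HasDerivAt (fun t : ℝ => G (z + t • Z)) (fderiv ℝ G z Z) 0 := by
    intro z Z h
    simpa using hasDerivAt_comp_line (k := G) (x := z) (a := Z) (t := 0) (by simpa using h)
  have htot := (hgap.sub (hψt.const_mul 2)).sub
    (((hG (Z := X) hGx).add (hG (Z := Y) hGy)).const_mul ε)
  have hmax' : IsLocalMax (fun t : ℝ => gradGap v (x + t • X) (y + t • Y)
      - 2 * ψ (‖(x + t • X) - (y + t • Y)‖ / 2) - ε * (G (x + t • X) + G (y + t • Y))) 0 := by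
    filter_upwards [hpath.eventually hmax] with t ht
    simpa using ht
  have hzero := hmax'.hasDerivAt_eq_zero htot
  have hW : fderiv ℝ v x (X - Y) - fderiv ℝ v y (X - Y) = ‖X - Y‖ ^ 2 := by
    rw [← inner_gradient, ← inner_gradient, ← inner_sub_left, ← hX, ← hY,
      real_inner_self_eq_norm_sq]
  have hWe : fderiv ℝ v x e - fderiv ℝ v y e = ⟪e, X - Y⟫ := by
    rw [← inner_gradient, ← inner_gradient, ← inner_sub_left, ← hX, ← hY, real_inner_comm]
  have hcs : ⟪e, X - Y⟫ ^ 2 ≤ ‖X - Y‖ ^ 2 := by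
    have := abs_real_inner_le_norm e (X - Y)
    rw [he, one_mul] at this
    exact sq_le_sq' (neg_le_of_abs_le this) (le_of_abs_le this)
  have hgg : gradGap v x y = ⟪e, X - Y⟫ := by
    rw [gradGap, hnorm, hxy, ← hWe]
    simp only [map_smul, smul_eq_mul]
    field_simp
  rw [hgg, fderiv_fderiv_apply hvx, fderiv_fderiv_apply hvy]
  simp only [zero_smul, add_zero, hnorm, Pi.sub_apply] at hzero
  rw [hxy] at hzero
  simp only [map_smul, smul_eq_mul] at hzero
  set P := fderiv ℝ (fderiv ℝ v) x X e
  set Q := fderiv ℝ (fderiv ℝ v) y Y e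
  set w := ⟪e, X - Y⟫
  have hq : (((r * P + fderiv ℝ v x (X - Y)) - (r * Q + fderiv ℝ v y (X - Y))) * r
      - (r * fderiv ℝ v x e - r * fderiv ℝ v y e) * w) / r ^ 2
      = P - Q + (‖X - Y‖ ^ 2 - w ^ 2) / r := by
    rw [← hW]
    have : fderiv ℝ v x e = w + fderiv ℝ v y e := by linarith
    rw [this]
    field_simp
    ring
  have hnn : 0 ≤ (‖X - Y‖ ^ 2 - w ^ 2) / r := div_nonneg (by linarith) hr.le
  linarith

/-- The two-point maximum principle for the modulus of expansion of `∇v`, with a penalty `G`. -/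
lemma two_point_maximum_principle {v G : EuclideanSpace ℝ (Fin n) → ℝ} {ψ ψ' : ℝ → ℝ}
    {ψ'' ε r : ℝ} {x y e : EuclideanSpace ℝ (Fin n)} (hr : 0 < r) (he : ‖e‖ = 1)
    (hxy : x - y = r • e) (hvx : ContDiffAt ℝ 3 v x) (hvy : ContDiffAt ℝ 3 v y)
    (hGx : ContDiffAt ℝ 2 G x) (hGy : ContDiffAt ℝ 2 G y)
    (hψ : ∀ᶠ s in nhds (r / 2), HasDerivAt ψ (ψ' s) s) (hψ' : HasDerivAt ψ' ψ'' (r / 2))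
    (hmax : IsLocalMax (fun p : EuclideanSpace ℝ (Fin n) × EuclideanSpace ℝ (Fin n) =>
      gradGap v p.1 p.2 - 2 * ψ (‖p.1 - p.2‖ / 2) - ε * (G p.1 + G p.2)) (x, y)) :
    (lap (fun z => fderiv ℝ v z e) x + 2 * fderiv ℝ (fun z => fderiv ℝ v z e) x (gradient v x))
      - (lap (fun z => fderiv ℝ v z e) y
        + 2 * fderiv ℝ (fun z => fderiv ℝ v z e) y (gradient v y))
      - 2 * ψ'' - 2 * ψ' (r / 2) * gradGap v x y
    ≤ ε * ((lap G x + 2 * fderiv ℝ G x (gradient v x))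
      + (lap G y + 2 * fderiv ℝ G y (gradient v y))) := by
  obtain ⟨b, hb⟩ := exists_reflected_basis he
  have h1 := first_variation hr he hxy (hvx.of_le (by norm_num)) (hvy.of_le (by norm_num))
    (hGx.differentiableAt (by norm_num)) (hGy.differentiableAt (by norm_num)) hψ.self_of_nhds hmax
  have h2 : ∑ i, _ ≤ ∑ _i : Fin n, (0 : ℝ) := Finset.sum_le_sum fun i _ =>
    second_variation_nonpos hr he hxy hvx hvy hGx hGy hψ hψ' hmax
    (EuclideanSpace.single i 1) (b i) (hb i)
  have hsum : ∑ i : Fin n, ⟪e, EuclideanSpace.single i 1⟫ ^ 2 = 1 := by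
    have := (EuclideanSpace.basisFun (Fin n) ℝ).sum_sq_inner_left e
    simpa [he] using this
  simp only [Finset.sum_sub_distrib, ← Finset.mul_sum, Finset.sum_add_distrib, hsum] at h2
  rw [lap_eq_sum_fderiv_fderiv (contDiffAt_fderiv_apply hvx e),
    lap_eq_sum_orthonormalBasis b (contDiffAt_fderiv_apply hvy e),
    lap_eq_sum_fderiv_fderiv hGx, lap_eq_sum_orthonormalBasis b hGy]
  simp only [Finset.sum_const_zero, mul_one] at h2
  linarith

end TwoPointMaximumPrinciple

section LogTransform

variable {n : ℕ}

lemma fderiv_fderiv_scalar_comp {E : Type*} [NormedAddCommGroup E] [NormedSpace ℝ E]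
    {f : E → ℝ} {x : E} {g g' : ℝ → ℝ} {g'' : ℝ}
    (hf : ContDiffAt ℝ 2 f x) (hg : ∀ᶠ s in nhds (f x), HasDerivAt g (g' s) s)
    (hg' : HasDerivAt g' g'' (f x)) (a b : E) :
    fderiv ℝ (fderiv ℝ fun z => g (f z)) x a b
      = g'' * (fderiv ℝ f x a * fderiv ℝ f x b) + g' (f x) * fderiv ℝ (fderiv ℝ f) x a b := by
  have h1 : fderiv ℝ (fun z => g (f z)) =ᶠ[nhds x] fun z => g' (f z) • fderiv ℝ f z := by
    filter_upwards [hf.continuousAt.eventually hg, hf.eventually (by norm_num)] with z hz hfz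
    exact (hz.comp_hasFDerivAt z (hfz.differentiableAt (by norm_num)).hasFDerivAt).fderiv
  have h2 := (hg'.comp_hasFDerivAt x (hf.differentiableAt (by norm_num)).hasFDerivAt).smul
    (differentiableAt_fderiv hf).hasFDerivAt
  rw [h1.fderiv_eq]
  erw [h2.fderiv]
  simp
  ring

lemma sum_fderiv_single_mul (f k : EuclideanSpace ℝ (Fin n) → ℝ) (x : EuclideanSpace ℝ (Fin n)) :
    ∑ i, fderiv ℝ f x (EuclideanSpace.single i 1) * fderiv ℝ k x (EuclideanSpace.single i 1)
      = fderiv ℝ k x (gradient f x) := by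
  rw [← inner_gradient x (gradient f x),
    ← (EuclideanSpace.basisFun (Fin n) ℝ).sum_inner_mul_inner (gradient k x) (gradient f x)]
  refine Finset.sum_congr rfl fun i _ => ?_
  rw [real_inner_comm (gradient f x), inner_gradient, inner_gradient]
  simp [mul_comm]

lemma fderiv_gradient_self (f : EuclideanSpace ℝ (Fin n) → ℝ) (x : EuclideanSpace ℝ (Fin n)) :
    fderiv ℝ f x (gradient f x) = ‖gradient f x‖ ^ 2 := by
  rw [← inner_gradient, real_inner_self_eq_norm_sq]

lemma lap_scalar_comp {f : EuclideanSpace ℝ (Fin n) → ℝ} {x : EuclideanSpace ℝ (Fin n)}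
    {g g' : ℝ → ℝ} {g'' : ℝ}
    (hf : ContDiffAt ℝ 2 f x) (hgf : ContDiffAt ℝ 2 (fun z => g (f z)) x)
    (hg : ∀ᶠ s in nhds (f x), HasDerivAt g (g' s) s) (hg' : HasDerivAt g' g'' (f x)) :
    lap (fun z => g (f z)) x = g'' * ‖gradient f x‖ ^ 2 + g' (f x) * lap f x := by
  rw [lap_eq_sum_fderiv_fderiv hgf, lap_eq_sum_fderiv_fderiv hf, ← fderiv_gradient_self,
    ← sum_fderiv_single_mul, Finset.mul_sum, Finset.mul_sum, ← Finset.sum_add_distrib]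
  exact Finset.sum_congr rfl fun i _ => fderiv_fderiv_scalar_comp hf hg hg' _ _

lemma lap_log {f : EuclideanSpace ℝ (Fin n) → ℝ} {x : EuclideanSpace ℝ (Fin n)} {q : ℝ}
    (hf : ContDiffAt ℝ 2 f x) (hpos : 0 < f x) (hq : lap f x = q * f x) :
    lap (fun z => Real.log (f z)) x = q - ‖gradient (fun z => Real.log (f z)) x‖ ^ 2 := by
  have hd : HasFDerivAt (fun z => Real.log (f z)) ((f x)⁻¹ • fderiv ℝ f x) x :=
    (hf.differentiableAt (by norm_num)).hasFDerivAt.log hpos.ne'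
  have hgrad : gradient (fun z => Real.log (f z)) x = (f x)⁻¹ • gradient f x := by
    rw [gradient, hd.fderiv, gradient]
    simp
  have hev : ∀ᶠ s in nhds (f x), HasDerivAt Real.log (s⁻¹) s := by
    filter_upwards [lt_mem_nhds hpos] with s hs
    exact Real.hasDerivAt_log hs.ne'
  rw [lap_scalar_comp hf (hf.log hpos.ne') hev (hasDerivAt_inv hpos.ne'), hq, hgrad, norm_smul,
    Real.norm_of_nonneg (inv_nonneg.2 hpos.le)]
  field_simp
  ring

lemma fderiv_fderiv_log {f : EuclideanSpace ℝ (Fin n) → ℝ} {x : EuclideanSpace ℝ (Fin n)}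
    (hf : ContDiffAt ℝ 2 f x) (hpos : 0 < f x) (a : EuclideanSpace ℝ (Fin n)) :
    fderiv ℝ (fderiv ℝ fun z => Real.log (f z)) x a a
      = (fderiv ℝ (fderiv ℝ f) x a a * f x - fderiv ℝ f x a ^ 2) / f x ^ 2 := by
  have hev : ∀ᶠ s in nhds (f x), HasDerivAt Real.log (s⁻¹) s := by
    filter_upwards [lt_mem_nhds hpos] with s hs
    exact Real.hasDerivAt_log hs.ne'
  rw [fderiv_fderiv_scalar_comp hf hev (hasDerivAt_inv hpos.ne')]
  field_simp
  ring

/-- The equation satisfied by the components of `∇v` when `Δv + |∇v|² = q`. -/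
lemma lap_fderiv_apply_add {v q : EuclideanSpace ℝ (Fin n) → ℝ} {x : EuclideanSpace ℝ (Fin n)}
    (hv : ContDiffAt ℝ 3 v x) (hq : DifferentiableAt ℝ q x)
    (heq : ∀ᶠ z in nhds x, lap v z = q z - ‖gradient v z‖ ^ 2) (e : EuclideanSpace ℝ (Fin n)) :
    lap (fun z => fderiv ℝ v z e) x + 2 * fderiv ℝ (fun z => fderiv ℝ v z e) x (gradient v x)
      = fderiv ℝ q x e := by
  set s : Fin n → EuclideanSpace ℝ (Fin n) := fun i => EuclideanSpace.single i 1 with hs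
  have hcomm : ∀ {f : EuclideanSpace ℝ (Fin n) → ℝ} {z}, ContDiffAt ℝ 2 f z → ∀ a b,
      fderiv ℝ (fun y => fderiv ℝ f y a) z b = fderiv ℝ (fun y => fderiv ℝ f y b) z a := by
    intro f z hf a b
    rw [fderiv_fderiv_apply hf, fderiv_fderiv_apply hf]
    exact (hf.isSymmSndFDerivAt (by simp)) b a
  have hv3 : ∀ᶠ z in nhds x, ContDiffAt ℝ 3 v z := hv.eventually (by norm_num)
  have hD : ∀ i, ContDiffAt ℝ 2 (fun z => fderiv ℝ v z (s i)) x :=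
    fun i => contDiffAt_fderiv_apply hv _
  have h1 : ∀ i, fderiv ℝ (fun y => fderiv ℝ (fun z => fderiv ℝ v z e) y (s i)) x (s i)
      = fderiv ℝ (fun y => fderiv ℝ (fun z => fderiv ℝ v z (s i)) y (s i)) x e := by
    intro i
    have : (fun y => fderiv ℝ (fun z => fderiv ℝ v z e) y (s i))
        =ᶠ[nhds x] fun y => fderiv ℝ (fun z => fderiv ℝ v z (s i)) y e := by
      filter_upwards [hv3] with y hy
      exact hcomm (hy.of_le (by norm_num)) _ _
    rw [this.fderiv_eq, hcomm (hD i)]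
  have hD2 : ∀ i, DifferentiableAt ℝ
      (fun y => fderiv ℝ (fun z => fderiv ℝ v z (s i)) y (s i)) x := fun i =>
    (differentiableAt_fderiv (hD i)).clm_apply (differentiableAt_const _)
  have h2 : lap (fun z => fderiv ℝ v z e) x = fderiv ℝ (lap v) x e := by
    have : fderiv ℝ (lap v) x
        = ∑ i, fderiv ℝ (fun y => fderiv ℝ (fun z => fderiv ℝ v z (s i)) y (s i)) x :=
      fderiv_fun_sum fun i _ => hD2 i
    rw [this, sum_apply, lap]
    exact Finset.sum_congr rfl fun i _ => h1 i
  have hD1 : ∀ i, DifferentiableAt ℝ (fun z => fderiv ℝ v z (s i)) x := fun i =>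
    (hD i).differentiableAt (by norm_num)
  have h3 : lap v =ᶠ[nhds x] fun z => q z - ∑ i, fderiv ℝ v z (s i) ^ 2 := by
    filter_upwards [heq] with z hz
    rw [hz, ← fderiv_gradient_self, ← sum_fderiv_single_mul]
    simp only [hs, sq]
  have h4 : HasFDerivAt (fun z => q z - ∑ i, fderiv ℝ v z (s i) ^ 2) (fderiv ℝ q x
      - ∑ i, (2 * fderiv ℝ v x (s i)) • fderiv ℝ (fun z => fderiv ℝ v z (s i)) x) x := by
    refine hq.hasFDerivAt.fun_sub (HasFDerivAt.fun_sum fun i _ => ?_)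
    simpa using (hD1 i).hasFDerivAt.pow 2
  rw [h2, h3.fderiv_eq, h4.fderiv, ← sum_fderiv_single_mul]
  simp only [sub_apply, sum_apply,
    smul_apply, smul_eq_mul, Finset.mul_sum]
  rw [sub_add, sub_eq_self, sub_eq_zero]
  refine Finset.sum_congr rfl fun i _ => ?_
  rw [hcomm (hv.of_le (by norm_num)) (s i) e]
  simp only [hs]
  ring

/-- The drift Laplacian of `exp (-p v)` when `Δv + |∇v|² = q`. -/
lemma lap_exp_neg_mul {v : EuclideanSpace ℝ (Fin n) → ℝ} {x : EuclideanSpace ℝ (Fin n)} {p q : ℝ}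
    (hv : ContDiffAt ℝ 2 v x) (heq : lap v x = q - ‖gradient v x‖ ^ 2) :
    lap (fun z => Real.exp (-p * v z)) x
        + 2 * fderiv ℝ (fun z => Real.exp (-p * v z)) x (gradient v x)
      = Real.exp (-p * v x) * (-(p * (1 - p) * ‖gradient v x‖ ^ 2) - p * q) := by
  have hg : ∀ s : ℝ, HasDerivAt (fun s => Real.exp (-p * s)) (Real.exp (-p * s) * -p) s := by
    intro s
    simpa using ((hasDerivAt_id s).const_mul (-p)).exp
  have h1 := lap_scalar_comp (g := fun s => Real.exp (-p * s)) (f := v) hv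
    ((contDiffAt_const.mul hv).exp) (Filter.Eventually.of_forall hg) ((hg (v x)).mul_const (-p))
  have h2 : fderiv ℝ (fun z => Real.exp (-p * v z)) x = (Real.exp (-p * v x) * -p) • fderiv ℝ v x :=
    ((hg (v x)).comp_hasFDerivAt x (hv.differentiableAt (by norm_num)).hasFDerivAt).fderiv
  rw [h1, h2, heq, smul_apply, fderiv_gradient_self]
  simp only [smul_eq_mul]
  ring

end LogTransform

section DistanceToBoundary

variable {n : ℕ} {Ω : Set (EuclideanSpace ℝ (Fin n))}

lemma IsOpen.notMem_frontier {X : Type*} [TopologicalSpace X] {s : Set X} (hs : IsOpen s) {x : X}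
    (hx : x ∈ s) : x ∉ frontier s := by
  rw [hs.frontier_eq]
  exact fun h => h.2 hx

lemma mem_of_mem_closure_of_infDist_pos {x : EuclideanSpace ℝ (Fin n)} (hx : x ∈ closure Ω)
    (hpos : 0 < infDist x (frontier Ω)) : x ∈ Ω := by
  by_contra hxΩ
  have : x ∈ frontier Ω := ⟨hx, fun h => hxΩ (interior_subset h)⟩
  rw [infDist_zero_of_mem this] at hpos
  exact hpos.false

lemma infDist_frontier_pos (hΩ : IsOpen Ω) (hne : (frontier Ω).Nonempty)
    {x : EuclideanSpace ℝ (Fin n)} (hx : x ∈ Ω) : 0 < infDist x (frontier Ω) :=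
  (isClosed_frontier.notMem_iff_infDist_pos hne).1 (hΩ.notMem_frontier hx)

lemma ball_infDist_frontier_subset (hΩ : IsOpen Ω) {x : EuclideanSpace ℝ (Fin n)} (hx : x ∈ Ω) :
    ball x (infDist x (frontier Ω)) ⊆ Ω := by
  rcases le_or_gt (infDist x (frontier Ω)) 0 with h0 | h0
  · rw [ball_eq_empty.2 h0]; exact empty_subset _
  refine IsPreconnected.subset_left_of_subset_union hΩ isClosed_closure.isOpen_compl
    (disjoint_compl_right_iff_subset.2 subset_closure) ?_ ⟨x, mem_ball_self h0, hx⟩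
    (convex_ball x _).isPreconnected
  intro w hw
  by_contra hcon
  simp only [mem_union, mem_compl_iff, not_or, not_not] at hcon
  have hwf : w ∈ frontier Ω := ⟨hcon.2, fun h => hcon.1 (interior_subset h)⟩
  have := infDist_le_dist_of_mem (x := x) hwf
  rw [mem_ball, dist_comm] at hw
  linarith

lemma infDist_frontier_segment (hΩ : IsOpen Ω) (hconv : Convex ℝ Ω) (hne : (frontier Ω).Nonempty)
    {x y z : EuclideanSpace ℝ (Fin n)} (hx : x ∈ Ω) (hy : y ∈ Ω) (hz : z ∈ segment ℝ x y) :
    min (infDist x (frontier Ω)) (infDist y (frontier Ω)) ≤ infDist z (frontier Ω) := by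
  refine (le_infDist hne).2 fun {q} hq => ?_
  by_contra! hlt
  obtain ⟨a, b, ha, hb, hab, rfl⟩ := hz
  set z := a • x + b • y
  have h1 : x + (q - z) ∈ Ω := ball_infDist_frontier_subset hΩ hx (by
    rw [mem_ball, dist_eq_norm, add_sub_cancel_left, ← dist_eq_norm, dist_comm]
    exact hlt.trans_le (min_le_left _ _))
  have h2 : y + (q - z) ∈ Ω := ball_infDist_frontier_subset hΩ hy (by
    rw [mem_ball, dist_eq_norm, add_sub_cancel_left, ← dist_eq_norm, dist_comm]
    exact hlt.trans_le (min_le_right _ _))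
  have h3 := hconv h1 h2 ha hb hab
  have h4 : a • (x + (q - z)) + b • (y + (q - z)) = q := by
    have : a • (x + (q - z)) + b • (y + (q - z)) = z + (a + b) • (q - z) := by
      simp only [z]; module
    rw [this, hab, one_smul]; abel
  rw [h4] at h3
  exact hΩ.notMem_frontier h3 hq

/-- At a point of differentiability, the distance to a closed set has slope one. -/
lemma one_le_of_isLocalMax_infDist_sub {s : Set (EuclideanSpace ℝ (Fin n))} (hs : IsClosed s)
    (hne : s.Nonempty) {x z : EuclideanSpace ℝ (Fin n)} {κ : ℝ} (hκ : 0 ≤ κ)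
    (hpos : 0 < infDist z s) (hd : DifferentiableAt ℝ (fun w => infDist w s) z)
    (hmax : IsLocalMax (fun w => infDist w s - κ * ‖w - x‖) z) : 1 ≤ κ := by
  obtain ⟨q, hq, hqd⟩ := hs.exists_infDist_eq_dist hne z
  set δ := infDist z s with hδ
  set u := δ⁻¹ • (z - q) with hu
  have hun : ‖u‖ = 1 := by
    rw [hu, norm_smul, ← dist_eq_norm, ← hqd, Real.norm_of_nonneg (inv_nonneg.2 hpos.le)]
    exact inv_mul_cancel₀ hpos.ne'
  have hzq : z - q = δ • u := by rw [hu, smul_smul, mul_inv_cancel₀ hpos.ne', one_smul]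
  have hg := hasDerivAt_comp_line (k := fun w => infDist w s) (x := z) (a := u) (t := 0)
    (by simpa using hd)
  set c := fderiv ℝ (fun w => infDist w s) (z + (0 : ℝ) • u) u
  have hleft : ∀ t ∈ Icc (-δ) 0, infDist (z + t • u) s = δ + t := by
    intro t ht
    apply le_antisymm
    · refine (infDist_le_dist_of_mem hq).trans (le_of_eq ?_)
      rw [dist_eq_norm, show z + t • u - q = (δ + t) • u by rw [add_smul, ← hzq]; abel, norm_smul,
        hun, mul_one, Real.norm_of_nonneg (by linarith [ht.1])]
    · have h := infDist_le_infDist_add_dist (s := s) (x := z) (y := z + t • u)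
      rw [dist_self_add_right, norm_smul, hun, mul_one, Real.norm_of_nonpos ht.2] at h
      linarith
  have hc : c = 1 := by
    have h1 : HasDerivWithinAt (fun t : ℝ => δ + t) c (Icc (-δ) 0) 0 :=
      hg.hasDerivWithinAt.congr (fun t ht => (hleft t ht).symm)
        (hleft 0 ⟨by linarith, le_rfl⟩).symm
    have h2 : HasDerivWithinAt (fun t : ℝ => δ + t) 1 (Icc (-δ) 0) 0 :=
      ((hasDerivAt_id (0 : ℝ)).const_add δ).hasDerivWithinAt
    exact (uniqueDiffOn_Icc (by linarith) 0 ⟨by linarith, le_rfl⟩).eq_deriv _ h1 h2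
  rw [hc] at hg
  have hslope := (hasDerivAt_iff_tendsto_slope.1 hg).mono_left
    (nhdsWithin_mono 0 (show Ioi (0 : ℝ) ⊆ {0}ᶜ from fun t ht => ne_of_gt ht))
  have hpath : Filter.Tendsto (fun t : ℝ => z + t • u) (nhds 0) (nhds z) := by
    have : Continuous fun t : ℝ => z + t • u := by fun_prop
    simpa using this.tendsto 0
  refine le_of_tendsto hslope ?_
  filter_upwards [(hpath.eventually hmax).filter_mono nhdsWithin_le_nhds,
    self_mem_nhdsWithin] with t ht htpos
  have htpos : 0 < t := htpos
  have h3 : ‖z + t • u - x‖ ≤ ‖z - x‖ + t := by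
    rw [show z + t • u - x = (z - x) + t • u by abel]
    refine (norm_add_le _ _).trans ?_
    rw [norm_smul, hun, mul_one, Real.norm_of_nonneg htpos.le]
  have h4 := mul_le_mul_of_nonneg_left h3 hκ
  simp only [slope, sub_zero, zero_smul, add_zero, vsub_eq_sub, smul_eq_mul]
  rw [inv_mul_le_iff₀ htpos]
  linarith

/-- Interior ball property, from differentiability of the distance function near the boundary. -/
lemma exists_interior_ball (hΩ : IsOpen Ω) (hne : (frontier Ω).Nonempty) {r₀ : ℝ}
    (hdiff : DifferentiableOn ℝ (fun x => infDist x (frontier Ω))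
      {x ∈ closure Ω | infDist x (frontier Ω) ≤ r₀})
    {x : EuclideanSpace ℝ (Fin n)} (hx : x ∈ Ω) (hxd : infDist x (frontier Ω) < r₀ / 2) :
    ∃ z ∈ Ω, infDist z (frontier Ω) = r₀ / 2 ∧ dist x z ≤ r₀ / 2 - infDist x (frontier Ω) := by
  set d : EuclideanSpace ℝ (Fin n) → ℝ := fun x => infDist x (frontier Ω) with hd
  have hdc : Continuous d := continuous_infDist_pt _
  have hdx : 0 < d x := infDist_frontier_pos hΩ hne hx
  set s := r₀ / 2 - d x with hs
  have hspos : 0 < s := by simp only [hs, hd]; linarith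
  set K := closedBall x s ∩ closure Ω with hK
  have hKc : IsCompact K := (isCompact_closedBall x s).inter_right isClosed_closure
  have hxK : x ∈ K := ⟨mem_closedBall_self hspos.le, subset_closure hx⟩
  obtain ⟨z, hzK, hzmax⟩ := hKc.exists_isMaxOn ⟨x, hxK⟩ hdc.continuousOn
  have hxz : dist x z ≤ s := by rw [dist_comm]; exact hzK.1
  have hzx : d x ≤ d z := hzmax hxK
  suffices h : d x + s ≤ d z by
    have h2 : d z ≤ d x + dist z x := infDist_le_infDist_add_dist
    rw [dist_comm] at h2
    exact ⟨z, mem_of_mem_closure_of_infDist_pos hzK.2 (hdx.trans_le hzx),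
      by simp only [hs, hd] at *; linarith, hxz⟩
  by_contra! hlt
  set κ := (d z - d x + s) / (2 * s) with hκ
  have hκpos : 0 < κ := by rw [hκ]; apply div_pos <;> linarith
  have hκs : κ * s = (d z - d x + s) / 2 := by rw [hκ]; field_simp
  have hκ1 : κ < 1 := by rw [hκ, div_lt_one (by linarith)]; linarith
  obtain ⟨w, hwK, hwmax⟩ := hKc.exists_isMaxOn ⟨x, hxK⟩
    (f := fun w => d w - κ * ‖w - x‖) (by fun_prop)
  have h1 : d x ≤ d w - κ * ‖w - x‖ := by simpa using hwmax hxK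
  have h2 : d w ≤ d z := hzmax hwK
  have h3 : ‖w - x‖ < s := by
    by_contra! hcon
    have := mul_le_mul_of_nonneg_left hcon hκpos.le
    linarith
  have hdw : 0 < d w := by
    have := mul_nonneg hκpos.le (norm_nonneg (w - x))
    linarith
  have hwΩ : w ∈ Ω := mem_of_mem_closure_of_infDist_pos hwK.2 hdw
  have hwK' : K ∈ nhds w := Filter.inter_mem
    (closedBall_mem_nhds_of_mem (by rwa [mem_ball, dist_eq_norm]))
    (Filter.mem_of_superset (hΩ.mem_nhds hwΩ) subset_closure)
  have hcol : {x ∈ closure Ω | infDist x (frontier Ω) ≤ r₀} ∈ nhds w := by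
    have : ∀ᶠ y in nhds w, d y < r₀ := hdc.continuousAt.eventually_lt_const (by linarith)
    filter_upwards [this, hΩ.mem_nhds hwΩ] with y hy hyΩ
    exact ⟨subset_closure hyΩ, hy.le⟩
  have := one_le_of_isLocalMax_infDist_sub isClosed_frontier hne hκpos.le hdw
    (hdiff.differentiableAt hcol) (hwmax.isLocalMax hwK')
  linarith

end DistanceToBoundary

section HopfLemma

variable {n : ℕ} {Ω : Set (EuclideanSpace ℝ (Fin n))}

lemma fderiv_fderiv_norm_sub_sq (x z a b : EuclideanSpace ℝ (Fin n)) :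
    fderiv ℝ (fderiv ℝ fun w => ‖w - z‖ ^ 2) x a b = 2 * ⟪a, b⟫ := by
  have h1 : (fderiv ℝ fun w : EuclideanSpace ℝ (Fin n) => ‖w - z‖ ^ 2)
      = fun w => (2 : ℝ) • innerSL ℝ (w - z) := by
    ext1 w
    have h : HasFDerivAt (fun w : EuclideanSpace ℝ (Fin n) => w - z) (ContinuousLinearMap.id ℝ _) w :=
      (hasFDerivAt_id w).sub_const z
    rw [h.norm_sq.fderiv]
    ext v
    simp
  rw [h1]
  have h2 : HasFDerivAt (fun w : EuclideanSpace ℝ (Fin n) => (2 : ℝ) • innerSL ℝ (w - z))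
      ((2 : ℝ) • (innerSL ℝ : EuclideanSpace ℝ (Fin n) →L[ℝ] _)) x :=
    ((innerSL ℝ : EuclideanSpace ℝ (Fin n) →L[ℝ] _).hasFDerivAt.comp x
      ((hasFDerivAt_id x).sub_const z)).const_smul (2 : ℝ)
  rw [h2.fderiv]
  simp
  rfl

lemma fderiv_norm_sub_sq (x z a : EuclideanSpace ℝ (Fin n)) :
    fderiv ℝ (fun w => ‖w - z‖ ^ 2) x a = 2 * ⟪x - z, a⟫ := by
  have h : HasFDerivAt (fun w : EuclideanSpace ℝ (Fin n) => w - z) (ContinuousLinearMap.id ℝ _) x :=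
    (hasFDerivAt_id x).sub_const z
  rw [h.norm_sq.fderiv]
  simp [inner_sub_left]

/-- The barrier in the Hopf boundary lemma. -/
noncomputable def hopfBarrier (α ρ : ℝ) (z w : EuclideanSpace ℝ (Fin n)) : ℝ :=
  Real.exp (-α * ‖w - z‖ ^ 2) - Real.exp (-α * ρ ^ 2)

lemma contDiff_hopfBarrier (α ρ : ℝ) (z : EuclideanSpace ℝ (Fin n)) :
    ContDiff ℝ 2 (hopfBarrier α ρ z) := by
  unfold hopfBarrier
  exact ((contDiff_const.mul ((contDiff_id.sub contDiff_const).norm_sq ℝ)).exp).sub contDiff_const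

lemma lap_hopfBarrier (α ρ : ℝ) (z w : EuclideanSpace ℝ (Fin n)) :
    lap (hopfBarrier α ρ z) w
      = Real.exp (-α * ‖w - z‖ ^ 2) * (4 * α ^ 2 * ‖w - z‖ ^ 2 - 2 * n * α) := by
  have hf : ContDiff ℝ 2 fun w : EuclideanSpace ℝ (Fin n) => ‖w - z‖ ^ 2 :=
    (contDiff_id.sub contDiff_const).norm_sq ℝ
  have hg : ∀ s : ℝ, HasDerivAt (fun s => Real.exp (-α * s)) (Real.exp (-α * s) * -α) s := by
    intro s
    simpa using ((hasDerivAt_id s).const_mul (-α)).exp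
  have h := lap_scalar_comp (f := fun w => ‖w - z‖ ^ 2) (x := w)
    (g := fun s => Real.exp (-α * s) - Real.exp (-α * ρ ^ 2)) hf.contDiffAt
    (contDiff_hopfBarrier α ρ z).contDiffAt
    (Filter.Eventually.of_forall fun s => (hg s).sub_const _)
    ((hg _).mul_const (-α))
  have hgrad : gradient (fun w : EuclideanSpace ℝ (Fin n) => ‖w - z‖ ^ 2) w = (2 : ℝ) • (w - z) := by
    refine ext_inner_right ℝ fun a => ?_
    rw [inner_gradient, fderiv_norm_sub_sq, inner_smul_left]
    simp
  have hlap : lap (fun w : EuclideanSpace ℝ (Fin n) => ‖w - z‖ ^ 2) w = 2 * n := by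
    rw [lap_eq_sum_fderiv_fderiv hf.contDiffAt]
    simp [fderiv_fderiv_norm_sub_sq]
    ring
  rw [hgrad, hlap, norm_smul] at h
  refine h.trans ?_
  simp only [Real.norm_ofNat]
  ring

/-- The Laplacians of two functions are ordered at a local minimum of their difference. -/
lemma lap_le_lap_of_isLocalMin {f g : EuclideanSpace ℝ (Fin n) → ℝ} {x : EuclideanSpace ℝ (Fin n)}
    {ε : ℝ} (hf : ContDiffAt ℝ 2 f x) (hg : ContDiffAt ℝ 2 g x)
    (hmin : IsLocalMin (fun w => f w - ε * g w) x) : ε * lap g x ≤ lap f x := by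
  rw [lap_eq_sum_fderiv_fderiv hf, lap_eq_sum_fderiv_fderiv hg, Finset.mul_sum]
  refine Finset.sum_le_sum fun i _ => ?_
  set a : EuclideanSpace ℝ (Fin n) := EuclideanSpace.single i 1
  have hpath : Filter.Tendsto (fun t : ℝ => x + t • a) (nhds 0) (nhds x) := by
    have : Continuous fun t : ℝ => x + t • a := by fun_prop
    simpa using this.tendsto 0
  have hmax : IsLocalMax (fun t : ℝ => ε * g (x + t • a) - f (x + t • a)) 0 := by
    filter_upwards [hpath.eventually hmin] with t ht
    simp only [zero_smul, add_zero] at ht ⊢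
    linarith
  have hd : ∀ {f : EuclideanSpace ℝ (Fin n) → ℝ} {z}, ContDiffAt ℝ 2 f z →
    DifferentiableAt ℝ f z := fun h => h.differentiableAt (by norm_num)
  have e0 : ∀ {f : EuclideanSpace ℝ (Fin n) → ℝ}, ContDiffAt ℝ 2 f x →
      HasDerivAt (fun t : ℝ => fderiv ℝ f (x + t • a) a) (fderiv ℝ (fderiv ℝ f) x a a) 0 := by
    intro f h
    simpa using hasDerivAt_fderiv_comp_line (k := f) (x := x) (a := a) (t := 0) (by simpa using h)
  have := second_deriv_nonpos_of_isLocalMax hmax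
    (f' := fun t => ε * fderiv ℝ g (x + t • a) a - fderiv ℝ f (x + t • a) a) (by
      filter_upwards [eventually_contDiffAt_line hf a, eventually_contDiffAt_line hg a] with t h1 h2
      exact ((hasDerivAt_comp_line (hd h2)).const_mul ε).sub (hasDerivAt_comp_line (hd h1)))
    (((e0 hg).const_mul ε).sub (e0 hf))
  linarith

/-- Comparison with the Hopf barrier in an annulus. -/
lemma hopfBarrier_le {φ : EuclideanSpace ℝ (Fin n) → ℝ} {Λ α ρ m : ℝ}
    {z x : EuclideanSpace ℝ (Fin n)}
    (hcont : ContinuousOn φ (closure Ω)) (hC2 : ∀ x ∈ Ω, ContDiffAt ℝ 2 φ x)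
    (hnonneg : ∀ x ∈ closure Ω, 0 ≤ φ x) (hΛ : 0 ≤ Λ) (hlap : ∀ x ∈ Ω, lap φ x ≤ Λ * φ x)
    (hρ : 0 < ρ) (hα : 0 < α) (hαρ : Λ < α ^ 2 * ρ ^ 2 - 2 * n * α) (hm : 0 < m)
    (hball : ball z ρ ⊆ Ω) (hinner : ∀ w, dist w z = ρ / 2 → m ≤ φ w)
    (hx1 : ρ / 2 ≤ dist x z) (hx2 : dist x z ≤ ρ) : m * hopfBarrier α ρ z x ≤ φ x := by
  set A : Set (EuclideanSpace ℝ (Fin n)) := {w | ρ / 2 ≤ dist w z} ∩ closedBall z ρ with hA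
  have hAc : IsCompact A := (isCompact_closedBall z ρ).inter_left
    (isClosed_le continuous_const (by fun_prop))
  have hAcl : A ⊆ closure Ω := fun w hw => by
    have : w ∈ closure (ball z ρ) := by rw [closure_ball z hρ.ne']; exact hw.2
    exact closure_mono hball this
  have hxA : x ∈ A := ⟨hx1, hx2⟩
  obtain ⟨w, hwA, hwmin⟩ := hAc.exists_isMinOn ⟨x, hxA⟩
    (f := fun w => φ w - m * hopfBarrier α ρ z w)
    ((hcont.mono hAcl).sub (continuous_const.mul (contDiff_hopfBarrier α ρ z).continuous).continuousOn)
  suffices h : 0 ≤ φ w - m * hopfBarrier α ρ z w by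
    have : φ w - m * hopfBarrier α ρ z w ≤ φ x - m * hopfBarrier α ρ z x := hwmin hxA
    linarith
  by_contra! hneg
  have hle1 : hopfBarrier α ρ z w ≤ Real.exp (-α * ‖w - z‖ ^ 2) := by
    have := Real.exp_pos (-α * ρ ^ 2)
    unfold hopfBarrier
    linarith
  have hexp1 : Real.exp (-α * ‖w - z‖ ^ 2) ≤ 1 :=
    Real.exp_le_one_iff.2 (by nlinarith [sq_nonneg ‖w - z‖])
  rcases eq_or_lt_of_le (show ρ / 2 ≤ dist w z from hwA.1) with h1 | h1
  · have := hinner w h1.symm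
    nlinarith
  rcases eq_or_lt_of_le (show dist w z ≤ ρ from hwA.2) with h2 | h2
  · have h0 : hopfBarrier α ρ z w = 0 := by
      rw [hopfBarrier, ← dist_eq_norm, h2, sub_self]
    have := hnonneg w (hAcl hwA)
    rw [h0] at hneg
    linarith
  have hwΩ : w ∈ Ω := hball h2
  have hnhds : A ∈ nhds w := Filter.inter_mem
    (Filter.mem_of_superset ((isOpen_lt continuous_const
      (by fun_prop : Continuous fun w => dist w z)).mem_nhds h1) fun y hy =>
      show ρ / 2 ≤ dist y z from le_of_lt hy)
    (closedBall_mem_nhds_of_mem h2)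
  have hmain := lap_le_lap_of_isLocalMin (hC2 w hwΩ) (contDiff_hopfBarrier α ρ z).contDiffAt
    (hwmin.isLocalMin hnhds)
  rw [lap_hopfBarrier] at hmain
  have h4 := hlap w hwΩ
  have hr : ρ ^ 2 / 4 ≤ ‖w - z‖ ^ 2 := by
    rw [← dist_eq_norm]; nlinarith
  have h5 : Λ < 4 * α ^ 2 * ‖w - z‖ ^ 2 - 2 * n * α := by nlinarith [sq_nonneg α]
  have hE := Real.exp_pos (-α * ‖w - z‖ ^ 2)
  set ex := Real.exp (-α * ‖w - z‖ ^ 2)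
  have h6 : m * (ex * Λ) < m * (ex * (4 * α ^ 2 * ‖w - z‖ ^ 2 - 2 * n * α)) := by gcongr
  have h7 : Λ * φ w ≤ Λ * (m * ex) := by
    gcongr
    nlinarith
  linarith

/-- The Hopf lemma in quantitative form: a positive supersolution grows at least linearly with the
distance to the boundary. -/
lemma exists_mul_infDist_le {φ : EuclideanSpace ℝ (Fin n) → ℝ} {Λ ρ : ℝ} (hΩ : IsOpen Ω)
    (hbdd : Bornology.IsBounded Ω) (hne : (frontier Ω).Nonempty)
    (hcont : ContinuousOn φ (closure Ω)) (hC2 : ∀ x ∈ Ω, ContDiffAt ℝ 2 φ x)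
    (hpos : ∀ x ∈ Ω, 0 < φ x) (hΛ : 0 ≤ Λ) (hlap : ∀ x ∈ Ω, lap φ x ≤ Λ * φ x) (hρ : 0 < ρ)
    (hball : ∀ x ∈ Ω, infDist x (frontier Ω) < ρ →
      ∃ z ∈ Ω, infDist z (frontier Ω) = ρ ∧ dist x z ≤ ρ - infDist x (frontier Ω)) :
    ∃ c > 0, ∀ x ∈ Ω, c * infDist x (frontier Ω) ≤ φ x := by
  set d : EuclideanSpace ℝ (Fin n) → ℝ := fun x => infDist x (frontier Ω) with hd
  have hdc : Continuous d := continuous_infDist_pt _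
  have hcl : IsCompact (closure Ω) := hbdd.isCompact_closure
  have hnonneg : ∀ x ∈ closure Ω, 0 ≤ φ x := fun x hx =>
    le_on_closure (f := fun _ => (0 : ℝ)) (fun y hy => (hpos y hy).le) continuousOn_const hcont hx
  set K := closure Ω ∩ {x | ρ / 2 ≤ d x} with hK
  have hKc : IsCompact K := hcl.inter_right (isClosed_le continuous_const hdc)
  have hKΩ : ∀ x ∈ K, x ∈ Ω := fun x hx =>
    mem_of_mem_closure_of_infDist_pos hx.1 (lt_of_lt_of_le (by positivity) hx.2)
  obtain ⟨m, hm, hmK⟩ : ∃ m > 0, ∀ x ∈ K, m ≤ φ x := by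
    rcases K.eq_empty_or_nonempty with h | h
    · exact ⟨1, one_pos, by simp [h]⟩
    · obtain ⟨w, hw, hmin⟩ := hKc.exists_isMinOn h (hcont.mono inter_subset_left)
      exact ⟨φ w, hpos w (hKΩ w hw), fun x hx => hmin hx⟩
  obtain ⟨B, hB⟩ := hcl.exists_bound_of_continuousOn (f := d) hdc.continuousOn
  set B' := max B 1 with hB'
  have hB'pos : 0 < B' := lt_of_lt_of_le one_pos (le_max_right _ _)
  set α := (2 * n + Λ + 1) / ρ ^ 2 + 1 with hα
  have hα1 : 1 ≤ α := by rw [hα]; have : 0 ≤ (2 * n + Λ + 1) / ρ ^ 2 := by positivity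
                         linarith
  have hαρ : Λ < α ^ 2 * ρ ^ 2 - 2 * n * α := by
    have h1 : α * ρ ^ 2 = 2 * n + Λ + 1 + ρ ^ 2 := by rw [hα]; field_simp
    have h2 : α ^ 2 * ρ ^ 2 - 2 * n * α = α * (Λ + 1 + ρ ^ 2) := by
      rw [show α ^ 2 * ρ ^ 2 = α * (α * ρ ^ 2) by ring, h1]; ring
    rw [h2]
    nlinarith [sq_nonneg ρ]
  set E := Real.exp (-α * ρ ^ 2) with hE
  have hEpos : 0 < E := Real.exp_pos _
  refine ⟨min (m / B') (m * (E * (α * ρ))), lt_min (by positivity) (by positivity), fun x hx => ?_⟩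
  have hdx : 0 < d x := infDist_frontier_pos hΩ hne hx
  rcases le_or_gt (ρ / 2) (d x) with h | h
  · have h1 : d x ≤ B' := (le_abs_self _).trans ((hB x (subset_closure hx)).trans (le_max_left _ _))
    calc min (m / B') (m * (E * (α * ρ))) * d x ≤ m / B' * B' := by
          gcongr; exact min_le_left _ _
      _ = m := by field_simp
      _ ≤ φ x := hmK x ⟨subset_closure hx, h⟩
  · obtain ⟨z, hz, hzd, hxz⟩ := hball x hx (by linarith)
    have hLip : ∀ w, ρ ≤ d w + dist w z := fun w => by
      have := infDist_le_infDist_add_dist (s := frontier Ω) (x := z) (y := w)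
      rw [hzd, dist_comm] at this
      exact this
    have hzball : ball z ρ ⊆ Ω := hzd ▸ ball_infDist_frontier_subset hΩ hz
    have hkey := hopfBarrier_le (x := x) hcont hC2 hnonneg hΛ hlap hρ (by linarith) hαρ hm hzball
      (fun w hw => hmK w ⟨subset_closure (hzball (by rw [mem_ball]; linarith)), by
        show ρ / 2 ≤ d w; linarith [hLip w]⟩)
      (by have := hLip x; linarith) (by linarith)
    have hr : ‖x - z‖ ≤ ρ - d x := by rw [← dist_eq_norm]; exact hxz
    have hb : E * (α * ρ) * d x ≤ hopfBarrier α ρ z x := by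
      have h1 : Real.exp (-α * ‖x - z‖ ^ 2) = E * Real.exp (α * (ρ ^ 2 - ‖x - z‖ ^ 2)) := by
        rw [hE, ← Real.exp_add]; ring_nf
      have h2 := Real.add_one_le_exp (α * (ρ ^ 2 - ‖x - z‖ ^ 2))
      have h3 : ρ * d x ≤ ρ ^ 2 - ‖x - z‖ ^ 2 := by
        have := norm_nonneg (x - z)
        nlinarith
      have h4 : α * (ρ * d x) ≤ α * (ρ ^ 2 - ‖x - z‖ ^ 2) := by gcongr
      rw [hopfBarrier, h1]
      have h5 : E * (α * (ρ * d x) + 1) ≤ E * Real.exp (α * (ρ ^ 2 - ‖x - z‖ ^ 2)) := by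
        gcongr; linarith
      linarith
    calc min (m / B') (m * (E * (α * ρ))) * d x ≤ m * (E * (α * ρ)) * d x := by
          gcongr; exact min_le_right _ _
      _ = m * (E * (α * ρ) * d x) := by ring
      _ ≤ m * hopfBarrier α ρ z x := by gcongr
      _ ≤ φ x := hkey

end HopfLemma
section BoundaryEstimates

set_option maxSynthPendingDepth 3

variable {n : ℕ} {Ω : Set (EuclideanSpace ℝ (Fin n))}

/-- A function which is smooth up to the boundary of a convex body has a derivative which is smooth
up to the boundary. -/
lemma exists_contDiffOn_eq_fderiv {F : Type*} [NormedAddCommGroup F] [NormedSpace ℝ F]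
    {f : EuclideanSpace ℝ (Fin n) → F} (hΩ : IsOpen Ω) (hne : Ω.Nonempty) (hconv : Convex ℝ Ω)
    (hf : ContDiffOn ℝ (⊤ : ℕ∞) f (closure Ω)) :
    ∃ g, ContDiffOn ℝ (⊤ : ℕ∞) g (closure Ω) ∧ ∀ x ∈ Ω, fderiv ℝ f x = g x := by
  have hu : UniqueDiffOn ℝ (closure Ω) := uniqueDiffOn_convex hconv.closure
    (hne.mono (interior_maximal subset_closure hΩ))
  refine ⟨fderivWithin ℝ f (closure Ω), hf.fderivWithin hu (by simp), fun x hx => ?_⟩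
  rw [fderivWithin_of_mem_nhds (Filter.mem_of_superset (hΩ.mem_nhds hx) subset_closure)]

lemma exists_pos_norm_le {F : Type*} [NormedAddCommGroup F] [NormedSpace ℝ F]
    {f : EuclideanSpace ℝ (Fin n) → F} (hbdd : Bornology.IsBounded Ω)
    (hf : ContinuousOn f (closure Ω)) : ∃ C > 0, ∀ x ∈ closure Ω, ‖f x‖ ≤ C := by
  obtain ⟨C, hC⟩ := hbdd.isCompact_closure.exists_bound_of_continuousOn hf
  exact ⟨max C 1, by positivity, fun x hx => (hC x hx).trans (le_max_left _ _)⟩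

/-- The derivatives up to order three of a function smooth up to the boundary are bounded. -/
lemma exists_fderiv_bounds {f : EuclideanSpace ℝ (Fin n) → ℝ} (hΩ : IsOpen Ω) (hne : Ω.Nonempty)
    (hconv : Convex ℝ Ω) (hbdd : Bornology.IsBounded Ω)
    (hf : ContDiffOn ℝ (⊤ : ℕ∞) f (closure Ω)) :
    ∃ L > 0, ∃ K > 0, ∃ M > 0, ∀ x ∈ Ω, ‖fderiv ℝ f x‖ ≤ L ∧ ‖fderiv ℝ (fderiv ℝ f) x‖ ≤ K ∧
      ‖fderiv ℝ (fderiv ℝ (fderiv ℝ f)) x‖ ≤ M := by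
  obtain ⟨g₁, hg₁, h₁⟩ := exists_contDiffOn_eq_fderiv hΩ hne hconv hf
  obtain ⟨g₂, hg₂, h₂⟩ := exists_contDiffOn_eq_fderiv hΩ hne hconv hg₁
  obtain ⟨g₃, hg₃, h₃⟩ := exists_contDiffOn_eq_fderiv hΩ hne hconv hg₂
  have h₂' : ∀ x ∈ Ω, fderiv ℝ (fderiv ℝ f) x = g₂ x := fun x hx => by
    rw [← h₂ x hx]
    exact Filter.EventuallyEq.fderiv_eq (Filter.eventually_of_mem (hΩ.mem_nhds hx) h₁)
  have h₃' : ∀ x ∈ Ω, fderiv ℝ (fderiv ℝ (fderiv ℝ f)) x = g₃ x := fun x hx => by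
    rw [← h₃ x hx]
    exact Filter.EventuallyEq.fderiv_eq (Filter.eventually_of_mem (hΩ.mem_nhds hx) h₂')
  obtain ⟨L, hL, hL'⟩ := exists_pos_norm_le hbdd hg₁.continuousOn
  obtain ⟨K, hK, hK'⟩ := exists_pos_norm_le hbdd hg₂.continuousOn
  obtain ⟨M, hM, hM'⟩ := exists_pos_norm_le hbdd hg₃.continuousOn
  refine ⟨L, hL, K, hK, M, hM, fun x hx => ⟨?_, ?_, ?_⟩⟩
  · rw [h₁ x hx]; exact hL' x (subset_closure hx)
  · rw [h₂' x hx]; exact hK' x (subset_closure hx)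
  · rw [h₃' x hx]; exact hM' x (subset_closure hx)

/-- Comparison of two functions on an interval through their derivatives. -/
lemma le_of_hasDerivAt_le {f f' g g' : ℝ → ℝ} {τ : ℝ} (hf : ContinuousOn f (Icc 0 τ))
    (hg : ContinuousOn g (Icc 0 τ)) (hf' : ∀ t ∈ Ico 0 τ, HasDerivAt f (f' t) t)
    (hg' : ∀ t ∈ Ico 0 τ, HasDerivAt g (g' t) t) (h0 : f 0 ≤ g 0)
    (hle : ∀ t ∈ Ico 0 τ, f' t ≤ g' t) {t : ℝ} (ht : t ∈ Icc 0 τ) : f t ≤ g t :=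
  image_le_of_deriv_right_le_deriv_boundary hf (fun t ht => (hf' t ht).hasDerivWithinAt) h0 hg
    (fun t ht => (hg' t ht).hasDerivWithinAt) hle ht

/-- A positive function on a bounded convex domain which vanishes on the boundary, has bounded
derivatives up to order three, and grows at least linearly away from the boundary. -/
structure LinearGrowth (Ω : Set (EuclideanSpace ℝ (Fin n))) (φ : EuclideanSpace ℝ (Fin n) → ℝ)
    (c L K M : ℝ) : Prop where
  isOpen : IsOpen Ω
  convex : Convex ℝ Ω
  frontier_nonempty : (frontier Ω).Nonempty
  continuousOn : ContinuousOn φ (closure Ω)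
  contDiffAt : ∀ x ∈ Ω, ContDiffAt ℝ 3 φ x
  pos : ∀ x ∈ Ω, 0 < φ x
  eq_zero : ∀ x ∈ frontier Ω, φ x = 0
  c_pos : 0 < c
  L_pos : 0 < L
  K_pos : 0 < K
  M_pos : 0 < M
  mul_infDist_le : ∀ x ∈ Ω, c * infDist x (frontier Ω) ≤ φ x
  norm_fderiv_le : ∀ x ∈ Ω, ‖fderiv ℝ φ x‖ ≤ L
  norm_fderiv₂_le : ∀ x ∈ Ω, ‖fderiv ℝ (fderiv ℝ φ) x‖ ≤ K
  norm_fderiv₃_le : ∀ x ∈ Ω, ‖fderiv ℝ (fderiv ℝ (fderiv ℝ φ)) x‖ ≤ M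

namespace LinearGrowth

variable {φ : EuclideanSpace ℝ (Fin n) → ℝ} {c L K M : ℝ} {x y a : EuclideanSpace ℝ (Fin n)}

lemma contDiffAt_two (h : LinearGrowth Ω φ c L K M) (hx : x ∈ Ω) : ContDiffAt ℝ 2 φ x :=
  (h.contDiffAt x hx).of_le (by norm_num)

lemma differentiableAt (h : LinearGrowth Ω φ c L K M) (hx : x ∈ Ω) : DifferentiableAt ℝ φ x :=
  (h.contDiffAt x hx).differentiableAt (by norm_num)

lemma infDist_pos (h : LinearGrowth Ω φ c L K M) (hx : x ∈ Ω) : 0 < infDist x (frontier Ω) :=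
  infDist_frontier_pos h.isOpen h.frontier_nonempty hx

lemma fderiv_mem (h : LinearGrowth Ω φ c L K M) (hx : x ∈ Ω) (ha : ‖a‖ = 1) :
    |fderiv ℝ φ x a| ≤ L := by
  have := (fderiv ℝ φ x).le_opNorm a
  rw [ha, mul_one] at this
  exact this.trans (h.norm_fderiv_le x hx)

lemma fderiv₂_mem (h : LinearGrowth Ω φ c L K M) (hx : x ∈ Ω) (ha : ‖a‖ = 1) :
    |fderiv ℝ (fderiv ℝ φ) x a a| ≤ K := by
  have := (fderiv ℝ (fderiv ℝ φ) x).le_opNorm₂ a a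
  rw [ha, mul_one, mul_one] at this
  exact this.trans (h.norm_fderiv₂_le x hx)

lemma fderiv₃_mem (h : LinearGrowth Ω φ c L K M) (hx : x ∈ Ω) (ha : ‖a‖ = 1) :
    |fderiv ℝ (fderiv ℝ (fderiv ℝ φ)) x a a a| ≤ M := by
  have h1 := (fderiv ℝ (fderiv ℝ (fderiv ℝ φ)) x a).le_opNorm₂ a a
  have h2 := (fderiv ℝ (fderiv ℝ (fderiv ℝ φ)) x).le_opNorm a
  rw [ha, mul_one, mul_one] at h1
  rw [ha, mul_one] at h2
  exact h1.trans (h2.trans (h.norm_fderiv₃_le x hx))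

lemma continuousOn_line (h : LinearGrowth Ω φ c L K M) {τ : ℝ}
    (hmem : ∀ t ∈ Icc 0 τ, x + t • a ∈ closure Ω) :
    ContinuousOn (fun t : ℝ => φ (x + t • a)) (Icc 0 τ) :=
  h.continuousOn.comp (by fun_prop) hmem

/-- The closed segment joins the closure if the half-open one lies in the domain. -/
lemma _root_.add_smul_mem_closure {τ : ℝ} (hτ : 0 < τ) (hmem : ∀ t ∈ Ico 0 τ, x + t • a ∈ Ω) :
    ∀ t ∈ Icc 0 τ, x + t • a ∈ closure Ω := by
  intro t ht
  have hc : Continuous fun t : ℝ => x + t • a := by fun_prop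
  rw [← closure_Ico hτ.ne] at ht
  exact map_mem_closure (f := fun t : ℝ => x + t • a) hc ht hmem

/-- The inner normal ray through an interior point. -/
lemma exists_ray (h : LinearGrowth Ω φ c L K M) (hx : x ∈ Ω) :
    ∃ a : EuclideanSpace ℝ (Fin n), ‖a‖ = 1 ∧
      (∀ t ∈ Ico 0 (infDist x (frontier Ω)), x + t • a ∈ Ω) ∧
      φ (x + infDist x (frontier Ω) • a) = 0 := by
  obtain ⟨q, hq, hqd⟩ := isClosed_frontier.exists_infDist_eq_dist h.frontier_nonempty x
  have hpos := h.infDist_pos hx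
  set δ := infDist x (frontier Ω) with hδ
  have hn : ‖q - x‖ = δ := by rw [hqd, dist_comm, dist_eq_norm]
  refine ⟨δ⁻¹ • (q - x), ?_, fun t ht => ball_infDist_frontier_subset h.isOpen hx ?_, ?_⟩
  · rw [norm_smul, hn, Real.norm_of_nonneg (by positivity)]; field_simp
  · rw [mem_ball, dist_eq_norm, add_sub_cancel_left, norm_smul, norm_smul, hn,
      Real.norm_of_nonneg ht.1, Real.norm_of_nonneg (by positivity)]
    field_simp
    exact ht.2
  · rw [smul_smul, mul_inv_cancel₀ hpos.ne', one_smul, add_sub_cancel]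
    exact h.eq_zero q hq

lemma le_mul_infDist (h : LinearGrowth Ω φ c L K M) (hx : x ∈ Ω) :
    φ x ≤ L * infDist x (frontier Ω) := by
  obtain ⟨a, ha, hmem, h0⟩ := h.exists_ray hx
  have hpos := h.infDist_pos hx
  have := le_of_hasDerivAt_le (f := fun t => φ x - L * t) (g := fun t => φ (x + t • a))
    (f' := fun _ => -L) (by fun_prop) (h.continuousOn_line (add_smul_mem_closure hpos hmem))
    (fun t _ => by simpa using ((hasDerivAt_id t).const_mul L).const_sub (φ x))
    (fun t ht => hasDerivAt_comp_line (h.differentiableAt (hmem t ht))) (by simp)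
    (fun t ht => (abs_le.1 (h.fderiv_mem (hmem t ht) ha)).1)
    (right_mem_Icc.2 hpos.le)
  simp only [h0] at this
  linarith

/-- The gradient does not degenerate near the boundary. -/
lemma half_le_norm_fderiv (h : LinearGrowth Ω φ c L K M) (hx : x ∈ Ω) (hφ : φ x ≤ c ^ 2 / K) :
    c / 2 ≤ ‖fderiv ℝ φ x‖ := by
  obtain ⟨a, ha, hmem, h0⟩ := h.exists_ray hx
  have hpos := h.infDist_pos hx
  have hc := h.c_pos
  have hK := h.K_pos
  have hlow := h.mul_infDist_le x hx
  set δ := infDist x (frontier Ω) with hδ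
  have h1 : ∀ t ∈ Ico 0 δ, fderiv ℝ φ x a - K * t ≤ fderiv ℝ φ (x + t • a) a := by
    intro t ht
    have hd : ∀ s ∈ Icc 0 t, HasDerivAt (fun s => fderiv ℝ φ (x + s • a) a)
        (fderiv ℝ (fderiv ℝ φ) (x + s • a) a a) s := fun s hs =>
      hasDerivAt_fderiv_comp_line (h.contDiffAt_two (hmem s ⟨hs.1, hs.2.trans_lt ht.2⟩))
    exact le_of_hasDerivAt_le (f := fun t => fderiv ℝ φ x a - K * t)
      (g := fun t => fderiv ℝ φ (x + t • a) a) (f' := fun _ => -K) (by fun_prop)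
      (fun s hs => (hd s hs).continuousAt.continuousWithinAt)
      (fun s _ => by simpa using ((hasDerivAt_id s).const_mul K).const_sub (fderiv ℝ φ x a))
      (fun s hs => hd s (Ico_subset_Icc_self hs)) (by simp)
      (fun s hs => (abs_le.1 (h.fderiv₂_mem (hmem s ⟨hs.1, hs.2.trans ht.2⟩) ha)).1)
      (right_mem_Icc.2 ht.1)
  have h2 := le_of_hasDerivAt_le (f := fun t => φ x + fderiv ℝ φ x a * t - K * t ^ 2 / 2)
    (g := fun t => φ (x + t • a)) (f' := fun t => fderiv ℝ φ x a - K * t) (by fun_prop)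
    (h.continuousOn_line (add_smul_mem_closure hpos hmem))
    (fun t _ => by
      have := (((hasDerivAt_id t).const_mul (fderiv ℝ φ x a)).const_add (φ x)).sub
        ((((hasDerivAt_id t).pow 2).const_mul K).div_const 2)
      exact this.congr_deriv (by simp; ring))
    (fun t ht => hasDerivAt_comp_line (h.differentiableAt (hmem t ht))) (by simp) h1
    (right_mem_Icc.2 hpos.le)
  simp only [h0] at h2
  have h3 : -fderiv ℝ φ x a ≤ ‖fderiv ℝ φ x‖ := by
    have := (fderiv ℝ φ x).le_opNorm a
    rw [ha, mul_one] at this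
    exact (neg_le_abs _).trans this
  have h4 : K * δ ≤ c := by
    have : c * δ ≤ c ^ 2 / K := hlow.trans hφ
    rw [le_div_iff₀ hK] at this
    nlinarith
  have h5 : (c / 2) * δ ≤ ‖fderiv ℝ φ x‖ * δ := by nlinarith
  exact le_of_mul_le_mul_right h5 hpos

/-- Taylor's formula along a segment on which the second derivative dominates. -/
lemma quadratic_le (h : LinearGrowth Ω φ c L K M) {A τ : ℝ} (ha : ‖a‖ = 1)
    (hA : fderiv ℝ (fderiv ℝ φ) x a a = A) (hA0 : 0 < A)
    (hb : fderiv ℝ φ x a ^ 2 ≤ A * φ x) (hτ : 0 < τ) (hτA : τ ≤ A / M)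
    (hmem : ∀ t ∈ Ico 0 τ, x + t • a ∈ Ω) : A * τ ^ 2 / 12 ≤ φ (x + τ • a) := by
  have hM := h.M_pos
  set b := fderiv ℝ φ x a with hbdef
  have h0 : ∀ t ∈ Ico 0 τ, A - M * t ≤ fderiv ℝ (fderiv ℝ φ) (x + t • a) a a := by
    intro t ht
    have hd : ∀ s ∈ Icc 0 t, HasDerivAt (fun s => fderiv ℝ (fderiv ℝ φ) (x + s • a) a a)
        (fderiv ℝ (fderiv ℝ (fderiv ℝ φ)) (x + s • a) a a a) s := fun s hs => by
      have hd1 : DifferentiableAt ℝ (fderiv ℝ (fderiv ℝ φ)) (x + s • a) := differentiableAt_fderiv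
        ((h.contDiffAt _ (hmem s ⟨hs.1, hs.2.trans_lt ht.2⟩)).fderiv_right (m := 2) (by norm_num))
      have hd2 : HasDerivAt (fun s : ℝ => x + s • a) a s := by
        simpa using ((hasDerivAt_id s).smul_const a).const_add x
      have hd3 := hd1.hasFDerivAt.comp_hasDerivAt s hd2
      have hd4 := (hd3.clm_apply (hasDerivAt_const s a)).clm_apply (hasDerivAt_const s a)
      simpa using hd4
    exact le_of_hasDerivAt_le (f := fun t => A - M * t)
      (g := fun t => fderiv ℝ (fderiv ℝ φ) (x + t • a) a a) (f' := fun _ => -M) (by fun_prop)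
      (fun s hs => (hd s hs).continuousAt.continuousWithinAt)
      (fun s _ => by simpa using ((hasDerivAt_id s).const_mul M).const_sub A)
      (fun s hs => hd s (Ico_subset_Icc_self hs)) (by simp [hA])
      (fun s hs => (abs_le.1 (h.fderiv₃_mem (hmem s ⟨hs.1, hs.2.trans ht.2⟩) ha)).1)
      (right_mem_Icc.2 ht.1)
  have h1 : ∀ t ∈ Ico 0 τ, b + A * t - M * t ^ 2 / 2 ≤ fderiv ℝ φ (x + t • a) a := by
    intro t ht
    have hd : ∀ s ∈ Icc 0 t, HasDerivAt (fun s => fderiv ℝ φ (x + s • a) a)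
        (fderiv ℝ (fderiv ℝ φ) (x + s • a) a a) s := fun s hs =>
      hasDerivAt_fderiv_comp_line (h.contDiffAt_two (hmem s ⟨hs.1, hs.2.trans_lt ht.2⟩))
    exact le_of_hasDerivAt_le (f := fun t => b + A * t - M * t ^ 2 / 2)
      (g := fun t => fderiv ℝ φ (x + t • a) a) (f' := fun t => A - M * t) (by fun_prop)
      (fun s hs => (hd s hs).continuousAt.continuousWithinAt)
      (fun s _ => by
        have := (((hasDerivAt_id s).const_mul A).const_add b).sub
          ((((hasDerivAt_id s).pow 2).const_mul M).div_const 2)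
        exact this.congr_deriv (by simp; ring))
      (fun s hs => hd s (Ico_subset_Icc_self hs)) (by simp [hbdef])
      (fun s hs => h0 s ⟨hs.1, hs.2.trans ht.2⟩) (right_mem_Icc.2 ht.1)
  have h2 := le_of_hasDerivAt_le (f := fun t => φ x + b * t + A * t ^ 2 / 2 - M * t ^ 3 / 6)
    (g := fun t => φ (x + t • a)) (f' := fun t => b + A * t - M * t ^ 2 / 2) (by fun_prop)
    (h.continuousOn_line (add_smul_mem_closure hτ hmem))
    (fun t _ => by
      have := ((((hasDerivAt_id t).const_mul b).const_add (φ x)).add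
        ((((hasDerivAt_id t).pow 2).const_mul A).div_const 2)).sub
        ((((hasDerivAt_id t).pow 3).const_mul M).div_const 6)
      exact this.congr_deriv (by simp; ring))
    (fun t ht => hasDerivAt_comp_line (h.differentiableAt (hmem t ht))) (by simp) h1
    (right_mem_Icc.2 hτ.le)
  have h3 : M * τ ^ 3 ≤ A * τ ^ 2 := by
    rw [le_div_iff₀ hM] at hτA
    nlinarith [sq_nonneg τ]
  have h4 : 0 ≤ φ x + b * τ + A * τ ^ 2 / 4 := by
    have : 0 ≤ A * (φ x + b * τ + A * τ ^ 2 / 4) := by nlinarith [sq_nonneg (b + A * τ / 2)]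
    exact nonneg_of_mul_nonneg_right this hA0
  linarith

/-- If the second derivative dominates, the domain extends at a definite distance. -/
lemma add_smul_mem (h : LinearGrowth Ω φ c L K M) {A : ℝ} (ha : ‖a‖ = 1)
    (hx : x ∈ Ω) (hA : fderiv ℝ (fderiv ℝ φ) x a a = A) (hA0 : 0 < A)
    (hb : fderiv ℝ φ x a ^ 2 ≤ A * φ x) :
    ∀ t ∈ Icc 0 (A / M), x + t • a ∈ Ω := by
  by_contra! hcon
  obtain ⟨t₀, ht₀, hmem₀⟩ := hcon
  have hc : Continuous fun t : ℝ => x + t • a := by fun_prop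
  obtain ⟨τ, hτ, hleast⟩ := (isCompact_Icc.inter_right (h.isOpen.isClosed_compl.preimage hc) :
    IsCompact (Icc 0 (A / M) ∩ (fun t : ℝ => x + t • a) ⁻¹' Ωᶜ)).exists_isLeast ⟨t₀, ht₀, hmem₀⟩
  have hτΩ : x + τ • a ∉ Ω := hτ.2
  have hτ0 : 0 < τ := by
    refine lt_of_le_of_ne hτ.1.1 fun h0 => hτΩ ?_
    simpa [← h0] using hx
  have hmem : ∀ t ∈ Ico 0 τ, x + t • a ∈ Ω := fun t ht => by
    by_contra hn
    exact absurd (hleast ⟨⟨ht.1, ht.2.le.trans hτ.1.2⟩, hn⟩) (not_le.2 ht.2)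
  have h1 := h.quadratic_le ha hA hA0 hb hτ0 hτ.1.2 hmem
  have h2 : x + τ • a ∈ frontier Ω :=
    ⟨add_smul_mem_closure hτ0 hmem τ (right_mem_Icc.2 hτ0.le), fun hi => hτΩ (interior_subset hi)⟩
  rw [h.eq_zero _ h2] at h1
  have : 0 < A * τ ^ 2 / 12 := by positivity
  linarith

/-- A positive part of the Hessian of `φ` which is not compensated by the gradient is small near
the boundary. -/
lemma cube_le (h : LinearGrowth Ω φ c L K M) {A : ℝ} (ha : ‖a‖ = 1)
    (hx : x ∈ Ω) (hA : fderiv ℝ (fderiv ℝ φ) x a a = A) (hA0 : 0 < A)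
    (hb : fderiv ℝ φ x a ^ 2 ≤ A * φ x) : A ^ 3 ≤ 12 * M ^ 2 * L / c * φ x := by
  have hM := h.M_pos
  have hL := h.L_pos
  have hc := h.c_pos
  have key : ∀ a : EuclideanSpace ℝ (Fin n), ‖a‖ = 1 → fderiv ℝ (fderiv ℝ φ) x a a = A →
      fderiv ℝ φ x a ^ 2 ≤ A * φ x → x + (A / M) • a ∈ Ω ∧
      A * (A / M) ^ 2 / 12 ≤ L * infDist (x + (A / M) • a) (frontier Ω) := by
    intro a ha hA hb
    have hmem := h.add_smul_mem ha hx hA hA0 hb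
    have hτ : 0 < A / M := by positivity
    have := hmem _ (right_mem_Icc.2 hτ.le)
    exact ⟨this, (h.quadratic_le ha hA hA0 hb hτ le_rfl
      fun t ht => hmem t (Ico_subset_Icc_self ht)).trans (h.le_mul_infDist this)⟩
  obtain ⟨h1, h1'⟩ := key a ha hA hb
  obtain ⟨h2, h2'⟩ := key (-a) (by rwa [norm_neg]) (by simpa using hA) (by simpa using hb)
  have hseg : x ∈ segment ℝ (x + (A / M) • a) (x + (A / M) • -a) := by
    refine ⟨1 / 2, 1 / 2, by norm_num, by norm_num, by norm_num, ?_⟩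
    module
  have h3 := infDist_frontier_segment h.isOpen h.convex h.frontier_nonempty h1 h2 hseg
  have h4 : A * (A / M) ^ 2 / 12 ≤ L * infDist x (frontier Ω) := by
    refine le_trans ?_ (mul_le_mul_of_nonneg_left h3 hL.le)
    rw [mul_min_of_nonneg _ _ hL.le]
    exact le_min h1' h2'
  have h5 := h.mul_infDist_le x hx
  calc A ^ 3 = 12 * M ^ 2 * (A * (A / M) ^ 2 / 12) := by field_simp
    _ ≤ 12 * M ^ 2 * (L * infDist x (frontier Ω)) := by gcongr
    _ = 12 * M ^ 2 * L / c * (c * infDist x (frontier Ω)) := by field_simp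
    _ ≤ 12 * M ^ 2 * L / c * φ x := by gcongr

end LinearGrowth

end BoundaryEstimates

section LogEstimates

variable {n : ℕ} {Ω : Set (EuclideanSpace ℝ (Fin n))}

lemma norm_gradient (f : EuclideanSpace ℝ (Fin n) → ℝ) (x : EuclideanSpace ℝ (Fin n)) :
    ‖gradient f x‖ = ‖fderiv ℝ f x‖ := by
  simp [gradient]

/-- The two-point function as a difference of directional derivatives. -/
lemma gradGap_eq_sub {v : EuclideanSpace ℝ (Fin n) → ℝ} {x y e : EuclideanSpace ℝ (Fin n)} {r : ℝ}
    (hr : 0 < r) (he : ‖e‖ = 1) (hxy : x - y = r • e) :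
    gradGap v x y = fderiv ℝ v x e - fderiv ℝ v y e := by
  have hn : ‖x - y‖ = r := by rw [hxy, norm_smul, he, Real.norm_of_nonneg hr.le, mul_one]
  rw [gradGap, hn, hxy, map_smul, map_smul, smul_eq_mul, smul_eq_mul]
  field_simp

lemma exists_unit_smul_eq_sub {x y : EuclideanSpace ℝ (Fin n)} (hxy : x ≠ y) :
    ∃ e : EuclideanSpace ℝ (Fin n), ‖e‖ = 1 ∧ x - y = ‖x - y‖ • e := by
  have h : 0 < ‖x - y‖ := norm_pos_iff.2 (sub_ne_zero.2 hxy)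
  refine ⟨‖x - y‖⁻¹ • (x - y), ?_, ?_⟩
  · rw [norm_smul, norm_inv, norm_norm, inv_mul_cancel₀ h.ne']
  · rw [smul_smul, mul_inv_cancel₀ h.ne', one_smul]

namespace LinearGrowth

variable {φ : EuclideanSpace ℝ (Fin n) → ℝ} {c L K M : ℝ} {x y a : EuclideanSpace ℝ (Fin n)}

lemma contDiffAt_log (h : LinearGrowth Ω φ c L K M) (hx : x ∈ Ω) :
    ContDiffAt ℝ 3 (fun z => Real.log (φ z)) x :=
  (h.contDiffAt x hx).log (h.pos x hx).ne'

lemma contDiffAt_two_log (h : LinearGrowth Ω φ c L K M) (hx : x ∈ Ω) :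
    ContDiffAt ℝ 2 (fun z => Real.log (φ z)) x :=
  (h.contDiffAt_log hx).of_le (by norm_num)

/-- Upper bound for the Hessian of `log φ`. -/
lemma exists_fderiv_fderiv_log_le (h : LinearGrowth Ω φ c L K M) :
    ∃ C > 0, ∀ x ∈ Ω, ∀ a : EuclideanSpace ℝ (Fin n), ‖a‖ = 1 →
      fderiv ℝ (fderiv ℝ fun z => Real.log (φ z)) x a a
        ≤ C * Real.exp (-(2 / 3) * Real.log (φ x)) := by
  set C₀ := 12 * M ^ 2 * L / c
  refine ⟨max 1 C₀, by positivity, fun x hx a ha => ?_⟩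
  have hφ := h.pos x hx
  rw [fderiv_fderiv_log (h.contDiffAt_two hx) hφ]
  set A := fderiv ℝ (fderiv ℝ φ) x a a with hA
  set b := fderiv ℝ φ x a with hb
  rcases le_or_gt (A * φ x) (b ^ 2) with hle | hlt
  · exact (div_nonpos_of_nonpos_of_nonneg (by linarith) (by positivity)).trans (by positivity)
  have hA0 : 0 < A := by
    by_contra! hn
    nlinarith [sq_nonneg b]
  have hcube := h.cube_le ha hx hA.symm hA0 hlt.le
  set w := Real.exp (Real.log (φ x) / 3) with hw
  have hw0 : 0 < w := Real.exp_pos _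
  have hw3 : w ^ 3 = φ x := by
    rw [hw, ← Real.exp_nat_mul, show ((3 : ℕ) : ℝ) * (Real.log (φ x) / 3) = Real.log (φ x) by
      push_cast; ring, Real.exp_log hφ]
  have hexp : Real.exp (-(2 / 3) * Real.log (φ x)) = (w ^ 2)⁻¹ := by
    rw [hw, ← Real.exp_nat_mul, ← Real.exp_neg]
    congr 1
    push_cast
    ring
  have hAw : A ≤ max 1 C₀ * w := by
    refine le_of_pow_le_pow_left₀ (n := 3) (by norm_num) (by positivity) ?_
    calc A ^ 3 ≤ C₀ * φ x := hcube
      _ ≤ max 1 C₀ ^ 3 * φ x := by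
          gcongr
          exact (le_max_right _ _).trans (le_self_pow₀ (le_max_left _ _) (by norm_num))
      _ = (max 1 C₀ * w) ^ 3 := by rw [mul_pow, hw3]
  rw [hexp]
  calc (A * φ x - b ^ 2) / φ x ^ 2 ≤ (A * φ x) / φ x ^ 2 := by
        gcongr
        linarith [sq_nonneg b]
    _ = A / w ^ 3 := by rw [hw3]; field_simp
    _ ≤ (max 1 C₀ * w) / w ^ 3 := by gcongr
    _ = max 1 C₀ * (w ^ 2)⁻¹ := by field_simp

/-- Along a segment, the function is bounded below by its values at the end points. -/
lemma mul_min_le (h : LinearGrowth Ω φ c L K M) (hx : x ∈ Ω) (hy : y ∈ Ω)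
    {z : EuclideanSpace ℝ (Fin n)} (hz : z ∈ segment ℝ x y) :
    c / L * min (φ x) (φ y) ≤ φ z := by
  have hL := h.L_pos
  have hc := h.c_pos
  have h1 := infDist_frontier_segment h.isOpen h.convex h.frontier_nonempty hx hy hz
  calc c / L * min (φ x) (φ y)
      ≤ c / L * min (L * infDist x (frontier Ω)) (L * infDist y (frontier Ω)) := by
        gcongr
        exacts [h.le_mul_infDist hx, h.le_mul_infDist hy]
    _ = c * min (infDist x (frontier Ω)) (infDist y (frontier Ω)) := by
        rw [← mul_min_of_nonneg _ _ hL.le]; field_simp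
    _ ≤ c * infDist z (frontier Ω) := by gcongr
    _ ≤ φ z := h.mul_infDist_le z (h.convex.segment_subset hx hy hz)

/-- Upper bound for the two-point function of `log φ`. -/
lemma exists_gradGap_le (h : LinearGrowth Ω φ c L K M) :
    ∃ C > 0, ∀ x ∈ Ω, ∀ y ∈ Ω, x ≠ y →
      gradGap (fun z => Real.log (φ z)) x y ≤ C * ‖x - y‖ *
        (Real.exp (-(2 / 3) * Real.log (φ x)) + Real.exp (-(2 / 3) * Real.log (φ y))) := by
  obtain ⟨C, hC, hbd⟩ := h.exists_fderiv_fderiv_log_le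
  have hL := h.L_pos
  have hc := h.c_pos
  refine ⟨C * Real.exp (-(2 / 3) * Real.log (c / L)), by positivity, fun x hx y hy hxy => ?_⟩
  set v := fun z => Real.log (φ z) with hv
  obtain ⟨e, he, hxye⟩ := exists_unit_smul_eq_sub hxy
  have hr : 0 < ‖x - y‖ := norm_pos_iff.2 (sub_ne_zero.2 hxy)
  rw [gradGap_eq_sub hr he hxye]
  set r := ‖x - y‖ with hrdef
  have hxe : x = y + r • e := by rw [← hxye]; abel
  set B := C * Real.exp (-(2 / 3) * Real.log (c / L)) *
    (Real.exp (-(2 / 3) * v x) + Real.exp (-(2 / 3) * v y)) with hB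
  have hseg : ∀ t ∈ Icc 0 r, y + t • e ∈ segment ℝ x y := fun t ht => by
    refine ⟨t / r, 1 - t / r, by have := ht.1; positivity, ?_, by ring, ?_⟩
    · rw [sub_nonneg, div_le_one hr]; exact ht.2
    · rw [hxe, smul_add, smul_smul, div_mul_cancel₀ _ hr.ne']
      module
  have hmem : ∀ t ∈ Icc 0 r, y + t • e ∈ Ω := fun t ht =>
    h.convex.segment_subset hx hy (hseg t ht)
  have hbound : ∀ t ∈ Icc 0 r, fderiv ℝ (fderiv ℝ v) (y + t • e) e e ≤ B := by
    intro t ht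
    refine (hbd _ (hmem t ht) e he).trans ?_
    rw [hB, mul_assoc]
    gcongr
    have h1 := h.mul_min_le hx hy (hseg t ht)
    have hxp := h.pos x hx
    have hyp := h.pos y hy
    have h2 : Real.log (c / L) + Real.log (min (φ x) (φ y)) ≤ Real.log (φ (y + t • e)) := by
      rw [← Real.log_mul (by positivity) (lt_min hxp hyp).ne']
      exact Real.log_le_log (mul_pos (by positivity) (lt_min hxp hyp)) h1
    have h3 : Real.exp (-(2 / 3) * Real.log (φ (y + t • e))) ≤
        Real.exp (-(2 / 3) * Real.log (c / L)) *
          Real.exp (-(2 / 3) * Real.log (min (φ x) (φ y))) := by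
      rw [← Real.exp_add]
      exact Real.exp_le_exp.2 (by linarith)
    refine h3.trans ?_
    gcongr
    have e1 := Real.exp_pos (-(2 / 3) * v x)
    have e2 := Real.exp_pos (-(2 / 3) * v y)
    rcases min_choice (φ x) (φ y) with h4 | h4 <;> rw [h4]
    · change Real.exp (-(2 / 3) * v x) ≤ _
      linarith
    · change Real.exp (-(2 / 3) * v y) ≤ _
      linarith
  have hd : ∀ t ∈ Icc 0 r, HasDerivAt (fun s => fderiv ℝ v (y + s • e) e)
      (fderiv ℝ (fderiv ℝ v) (y + t • e) e e) t := fun t ht =>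
    hasDerivAt_fderiv_comp_line (h.contDiffAt_two_log (hmem t ht))
  have := le_of_hasDerivAt_le (f := fun s => fderiv ℝ v (y + s • e) e)
    (g := fun s => fderiv ℝ v y e + B * s) (g' := fun _ => B)
    (fun s hs => (hd s hs).continuousAt.continuousWithinAt) (by fun_prop)
    (fun s hs => hd s (Ico_subset_Icc_self hs))
    (fun s _ => by simpa using ((hasDerivAt_id s).const_mul B).const_add (fderiv ℝ v y e))
    (by simp) (fun s hs => hbound s (Ico_subset_Icc_self hs)) (right_mem_Icc.2 hr.le)
  simp only [← hxe] at this
  linarith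

/-- A negative power of `φ` is almost a subsolution of the drift Laplacian. -/
lemma exists_drift_lap_le (h : LinearGrowth Ω φ c L K M) {q : EuclideanSpace ℝ (Fin n) → ℝ} {Λ : ℝ}
    (hlap : ∀ x ∈ Ω, lap φ x = q x * φ x) (hq : ∀ x ∈ Ω, |q x| ≤ Λ) (hΛ : 0 < Λ) :
    ∃ C > 0, ∀ x ∈ Ω, lap (fun z => Real.exp (-(3 / 4) * Real.log (φ z))) x
      + 2 * fderiv ℝ (fun z => Real.exp (-(3 / 4) * Real.log (φ z))) x
        (gradient (fun z => Real.log (φ z)) x) ≤ C := by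
  have hc := h.c_pos
  have hK := h.K_pos
  set η := min (c ^ 2 / K) (c / (4 * (Λ + 1))) with hη
  have hη0 : 0 < η := lt_min (by positivity) (by positivity)
  refine ⟨Real.exp (-(3 / 4) * Real.log η) * Λ, by positivity, fun x hx => ?_⟩
  have hφ := h.pos x hx
  rw [lap_exp_neg_mul (h.contDiffAt_two_log hx) (lap_log (h.contDiffAt_two hx) hφ (hlap x hx))]
  have hqx := (abs_le.1 (hq x hx)).1
  set g := ‖gradient (fun z => Real.log (φ z)) x‖ with hg
  rcases le_or_gt (φ x) η with hle | hgt
  · have h1 := h.half_le_norm_fderiv hx (hle.trans (min_le_left _ _))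
    have h2 : g = ‖fderiv ℝ φ x‖ / φ x := by
      rw [hg, norm_gradient, ((h.differentiableAt hx).hasFDerivAt.log hφ.ne').fderiv, norm_smul,
        Real.norm_of_nonneg (by positivity)]
      field_simp
    have h3 : 2 * (Λ + 1) ≤ g := by
      have h4 : φ x ≤ c / (4 * (Λ + 1)) := hle.trans (min_le_right _ _)
      rw [le_div_iff₀ (by positivity)] at h4
      rw [h2, le_div_iff₀ hφ]
      linarith
    have h5 : -(3 / 4 * (1 - 3 / 4) * g ^ 2) - 3 / 4 * q x ≤ 0 := by nlinarith
    exact (mul_nonpos_of_nonneg_of_nonpos (Real.exp_pos _).le h5).trans (by positivity)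
  · have h1 : -(3 / 4 * (1 - 3 / 4) * g ^ 2) - 3 / 4 * q x ≤ Λ := by nlinarith [sq_nonneg g]
    have h2 : Real.exp (-(3 / 4) * Real.log (φ x)) ≤ Real.exp (-(3 / 4) * Real.log η) := by
      have := Real.log_le_log hη0 hgt.le
      exact Real.exp_le_exp.2 (by linarith)
    calc _ ≤ Real.exp (-(3 / 4) * Real.log (φ x)) * Λ := by gcongr
      _ ≤ _ := by gcongr

end LinearGrowth

end LogEstimates

section TwoPoint

variable {n : ℕ} {Ω : Set (EuclideanSpace ℝ (Fin n))}

/-- The profile `s ↦ -κ tan (κ s)` and its derivatives. -/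
lemma hasDerivAt_neg_mul_tan {κ s : ℝ} (hs : Real.cos (κ * s) ≠ 0) :
    HasDerivAt (fun s => -(κ * Real.tan (κ * s))) (-(κ ^ 2 * (1 + Real.tan (κ * s) ^ 2))) s := by
  have h1 : HasDerivAt (fun s => κ * s) κ s := by simpa using (hasDerivAt_id s).const_mul κ
  have h2 := (((Real.hasDerivAt_tan hs).comp s h1).const_mul κ).neg
  refine h2.congr_deriv ?_
  rw [one_div, ← Real.inv_one_add_tan_sq hs, inv_inv]
  ring

lemma hasDerivAt_neg_mul_one_add_tan_sq {κ s : ℝ} (hs : Real.cos (κ * s) ≠ 0) :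
    HasDerivAt (fun s => -(κ ^ 2 * (1 + Real.tan (κ * s) ^ 2)))
      (-(2 * κ ^ 3 * Real.tan (κ * s) * (1 + Real.tan (κ * s) ^ 2))) s := by
  have h1 : HasDerivAt (fun s => κ * s) κ s := by simpa using (hasDerivAt_id s).const_mul κ
  have h2 := (((((Real.hasDerivAt_tan hs).comp s h1).pow 2).const_add 1).const_mul (κ ^ 2)).neg
  refine h2.congr_deriv ?_
  rw [one_div, ← Real.inv_one_add_tan_sq hs, inv_inv]
  simp only [Function.comp]
  push_cast
  ring

/-- The derivative of a convex function is monotone along lines. -/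
lemma fderiv_le_fderiv_of_convexOn {q : EuclideanSpace ℝ (Fin n) → ℝ}
    {x y e : EuclideanSpace ℝ (Fin n)} {r : ℝ} (hq : ConvexOn ℝ Ω q) (hx : x ∈ Ω) (hy : y ∈ Ω)
    (hqx : DifferentiableAt ℝ q x) (hqy : DifferentiableAt ℝ q y) (hr : 0 < r)
    (hxy : x - y = r • e) : fderiv ℝ q y e ≤ fderiv ℝ q x e := by
  have hxe : x = y + r • e := by rw [← hxy]; abel
  have hc := hq.comp_affineMap (AffineMap.lineMap y (y + e))
  have hfun : q ∘ AffineMap.lineMap y (y + e) = fun t : ℝ => q (y + t • e) := by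
    ext t
    simp [AffineMap.lineMap_apply, add_comm]
  rw [hfun] at hc
  have h0 : (0 : ℝ) ∈ AffineMap.lineMap y (y + e) ⁻¹' Ω := by simpa using hy
  have h1 : r ∈ AffineMap.lineMap y (y + e) ⁻¹' Ω := by
    rw [mem_preimage, AffineMap.lineMap_apply]
    simpa [add_comm, hxe] using hx
  have d0 := hasDerivAt_comp_line (k := q) (x := y) (a := e) (t := 0) (by simpa using hqy)
  have d1 := hasDerivAt_comp_line (k := q) (x := y) (a := e) (t := r) (by rwa [← hxe])
  rw [zero_smul, add_zero] at d0
  rw [← hxe] at d1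
  exact (hc.le_slope_of_hasDerivAt h0 h1 hr d0).trans (hc.slope_le_of_hasDerivAt h0 h1 hr d1)

/-- A function on an open set attains a local maximum if it is smaller than one of its values
outside a compact set. -/
lemma exists_isLocalMax_of_isCompact {X : Type*} [TopologicalSpace X] {U S : Set X} {f : X → ℝ}
    {p₀ : X} (hU : IsOpen U) (hS : IsCompact S) (hSU : S ⊆ U) (hf : ContinuousOn f S)
    (hp₀ : p₀ ∈ U) (hlt : ∀ p ∈ U, f p₀ ≤ f p → p ∈ S) :
    ∃ p ∈ U, IsLocalMax f p ∧ f p₀ ≤ f p := by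
  obtain ⟨p, hpS, hmax⟩ := hS.exists_isMaxOn ⟨p₀, hlt p₀ hp₀ le_rfl⟩ hf
  have h0 : f p₀ ≤ f p := hmax (hlt p₀ hp₀ le_rfl)
  refine ⟨p, hSU hpS, ?_, h0⟩
  filter_upwards [hU.mem_nhds (hSU hpS)] with p' hp'
  by_contra! hcon
  exact (hmax (hlt p' hp' (h0.trans hcon.le))).not_gt hcon

namespace LinearGrowth

variable {φ : EuclideanSpace ℝ (Fin n) → ℝ} {c L K M : ℝ} {x y a : EuclideanSpace ℝ (Fin n)}

/-- The superlevel sets of the penalized two-point function stay away from the boundary and from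
the diagonal. -/
lemma exists_le_of_superlevel (h : LinearGrowth Ω φ c L K M) (hbdd : Bornology.IsBounded Ω)
    {ψ : ℝ → ℝ} {B ε m : ℝ} (hψc : ContinuousAt ψ 0) (hψ0 : ψ 0 = 0)
    (hB : ∀ s ∈ Icc 0 (diam Ω / 2), -(2 * ψ s) ≤ B) (hε : 0 < ε) (hm : 0 < m) :
    ∃ η > 0, ∃ δ > 0, ∀ x ∈ Ω, ∀ y ∈ Ω, x ≠ y →
      m ≤ gradGap (fun z => Real.log (φ z)) x y - 2 * ψ (‖x - y‖ / 2)
        - ε * (Real.exp (-(3 / 4) * Real.log (φ x)) + Real.exp (-(3 / 4) * Real.log (φ y))) →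
      η ≤ φ x ∧ η ≤ φ y ∧ δ ≤ ‖x - y‖ := by
  obtain ⟨C, hC, hgap⟩ := h.exists_gradGap_le
  set w : EuclideanSpace ℝ (Fin n) → ℝ := fun x => Real.exp (-(1 / 12) * Real.log (φ x)) with hw
  have hw0 : ∀ x, 0 < w x := fun x => Real.exp_pos _
  have hw8 : ∀ x, Real.exp (-(2 / 3) * Real.log (φ x)) = w x ^ 8 := fun x => by
    rw [hw, ← Real.exp_nat_mul]; congr 1; push_cast; ring
  have hw9 : ∀ x, Real.exp (-(3 / 4) * Real.log (φ x)) = w x ^ 9 := fun x => by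
    rw [hw, ← Real.exp_nat_mul]; congr 1; push_cast; ring
  simp only [hw8, hw9] at hgap ⊢
  have hdiam : 0 ≤ diam Ω := diam_nonneg
  set C' := C * diam Ω with hC'
  have hC'0 : 0 ≤ C' := by positivity
  set P := C' * (C' / ε) ^ 8 with hP
  have hS : ∀ t : ℝ, 0 < t → C' * t ^ 8 - ε * t ^ 9 ≤ P := by
    intro t ht
    rcases le_or_gt t (C' / ε) with hle | hgt
    · have : C' * t ^ 8 ≤ P := by rw [hP]; gcongr
      have : 0 < ε * t ^ 9 := by positivity
      linarith
    · rw [div_lt_iff₀ hε] at hgt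
      have h1 : C' * t ^ 8 - ε * t ^ 9 = -((t * ε - C') * t ^ 8) := by ring
      have h2 : 0 ≤ (t * ε - C') * t ^ 8 := by
        have : 0 ≤ t * ε - C' := by linarith
        positivity
      have h3 : 0 ≤ P := by positivity
      linarith
  set W := max 1 (max ((C' + 1) / ε) (P + B)) with hW
  have hW1 : 1 ≤ W := le_max_left _ _
  have hlarge : ∀ t : ℝ, W ≤ t → C' * t ^ 8 - ε * t ^ 9 + (P + B) ≤ 0 := by
    intro t ht
    have h1 : 1 ≤ t := hW1.trans ht
    have h2 : (C' + 1) / ε ≤ t := ((le_max_left _ _).trans (le_max_right _ _)).trans ht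
    have h3 : P + B ≤ t := ((le_max_right _ _).trans (le_max_right _ _)).trans ht
    rw [div_le_iff₀ hε] at h2
    have h4 : t ≤ t ^ 8 := le_self_pow₀ h1 (by norm_num)
    have h5 : C' * t ^ 8 - ε * t ^ 9 = -((t * ε - C') * t ^ 8) := by ring
    have h6 : 1 * t ^ 8 ≤ (t * ε - C') * t ^ 8 := by
      gcongr
      linarith
    linarith
  set g : ℝ → ℝ := fun r => 2 * C * W ^ 8 * r - 2 * ψ (r / 2) with hg
  have hgc : Filter.Tendsto g (nhds 0) (nhds 0) := by
    have h1 : ContinuousAt (fun r : ℝ => ψ (r / 2)) 0 := by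
      refine ContinuousAt.comp (g := ψ) ?_ (by fun_prop)
      simpa using hψc
    have h2 : ContinuousAt g 0 := by
      exact ContinuousAt.sub (by fun_prop) (h1.const_mul 2)
    have h3 : g 0 = 0 := by simp [hg, hψ0]
    simpa [ContinuousAt, h3] using h2
  obtain ⟨δ, hδ, hδg⟩ := Metric.eventually_nhds_iff.1 (hgc.eventually (gt_mem_nhds hm))
  refine ⟨Real.exp (-12 * Real.log W), Real.exp_pos _, δ, hδ, fun x hx y hy hxy hle => ?_⟩
  have hgapxy := hgap x hx y hy hxy
  have hdist : ‖x - y‖ ≤ diam Ω := by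
    rw [← dist_eq_norm]; exact dist_le_diam_of_mem hbdd hx hy
  have hx0 := hw0 x
  have hy0 := hw0 y
  have hBxy := hB (‖x - y‖ / 2) ⟨by positivity, by linarith⟩
  have hCd : C * ‖x - y‖ * (w x ^ 8 + w y ^ 8) ≤ C' * (w x ^ 8 + w y ^ 8) := by
    rw [hC']; gcongr
  have hxW : w x < W := by
    by_contra! hcon
    have h1 := hlarge _ hcon
    have h2 := hS _ hy0
    linarith
  have hyW : w y < W := by
    by_contra! hcon
    have h1 := hlarge _ hcon
    have h2 := hS _ hx0
    linarith
  have hlow : ∀ z ∈ Ω, w z < W → Real.exp (-12 * Real.log W) ≤ φ z := by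
    intro z hz hzW
    rw [← Real.exp_log (h.pos z hz)]
    have := (Real.lt_log_iff_exp_lt (by linarith)).2 hzW
    exact Real.exp_le_exp.2 (by linarith)
  refine ⟨hlow x hx hxW, hlow y hy hyW, ?_⟩
  by_contra! hcon
  have h1 := hδg (y := ‖x - y‖) (by simpa using hcon)
  have h2 : C * ‖x - y‖ * (w x ^ 8 + w y ^ 8) ≤ C * ‖x - y‖ * (W ^ 8 + W ^ 8) := by gcongr
  have h3 : 0 < ε * (w x ^ 9 + w y ^ 9) := by positivity
  simp only [hg] at h1
  linarith

lemma continuousAt_penalized (h : LinearGrowth Ω φ c L K M) {ψ : ℝ → ℝ} {ε : ℝ}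
    (hx : x ∈ Ω) (hy : y ∈ Ω) (hxy : x ≠ y) (hψ : ContinuousAt ψ (‖x - y‖ / 2)) :
    ContinuousAt (fun p : EuclideanSpace ℝ (Fin n) × EuclideanSpace ℝ (Fin n) =>
      gradGap (fun z => Real.log (φ z)) p.1 p.2 - 2 * ψ (‖p.1 - p.2‖ / 2)
        - ε * (Real.exp (-(3 / 4) * Real.log (φ p.1)) + Real.exp (-(3 / 4) * Real.log (φ p.2))))
      (x, y) := by
  have hd : ∀ {z}, z ∈ Ω → ContinuousAt (fderiv ℝ fun z => Real.log (φ z)) z := fun hz =>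
    ((h.contDiffAt_two_log hz).fderiv_right (m := 1) (by norm_num)).continuousAt
  have hv : ∀ {z}, z ∈ Ω → ContinuousAt (fun z => Real.log (φ z)) z := fun hz =>
    (h.contDiffAt_two_log hz).continuousAt
  have h1 : ContinuousAt (fun p : EuclideanSpace ℝ (Fin n) × EuclideanSpace ℝ (Fin n) =>
      fderiv ℝ (fun z => Real.log (φ z)) p.1) (x, y) :=
    ContinuousAt.comp (x := (x, y)) (hd hx) continuousAt_fst
  have h2 : ContinuousAt (fun p : EuclideanSpace ℝ (Fin n) × EuclideanSpace ℝ (Fin n) =>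
      fderiv ℝ (fun z => Real.log (φ z)) p.2) (x, y) :=
    ContinuousAt.comp (x := (x, y)) (hd hy) continuousAt_snd
  have h3 : ContinuousAt (fun p : EuclideanSpace ℝ (Fin n) × EuclideanSpace ℝ (Fin n) =>
      Real.log (φ p.1)) (x, y) :=
    ContinuousAt.comp (x := (x, y)) (hv hx) continuousAt_fst
  have h4 : ContinuousAt (fun p : EuclideanSpace ℝ (Fin n) × EuclideanSpace ℝ (Fin n) =>
      Real.log (φ p.2)) (x, y) :=
    ContinuousAt.comp (x := (x, y)) (hv hy) continuousAt_snd
  have h5 : ContinuousAt (fun p : EuclideanSpace ℝ (Fin n) × EuclideanSpace ℝ (Fin n) =>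
      ψ (‖p.1 - p.2‖ / 2)) (x, y) :=
    ContinuousAt.comp (x := (x, y)) (g := ψ) hψ
      (by fun_prop : Continuous fun p : EuclideanSpace ℝ (Fin n) × EuclideanSpace ℝ (Fin n) =>
        ‖p.1 - p.2‖ / 2).continuousAt
  have h6 : ContinuousAt (fun p : EuclideanSpace ℝ (Fin n) × EuclideanSpace ℝ (Fin n) =>
      p.1 - p.2) (x, y) := by fun_prop
  have h7 : ‖x - y‖ ≠ 0 := norm_ne_zero_iff.2 (sub_ne_zero.2 hxy)
  refine ((((h1.clm_apply h6).sub (h2.clm_apply h6)).div h6.norm h7).sub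
    (h5.const_mul 2)).sub ?_
  exact (((h3.const_mul _).rexp).add ((h4.const_mul _).rexp)).const_mul ε

/-- The modulus of log-concavity for a subcritical frequency. -/
lemma gradGap_log_le (h : LinearGrowth Ω φ c L K M) (hbdd : Bornology.IsBounded Ω)
    {q : EuclideanSpace ℝ (Fin n) → ℝ} {Λ : ℝ} (hlap : ∀ x ∈ Ω, lap φ x = q x * φ x)
    (hq : ∀ x ∈ Ω, |q x| ≤ Λ) (hΛ : 0 < Λ) (hqd : ∀ x ∈ Ω, DifferentiableAt ℝ q x)
    (hqc : ConvexOn ℝ Ω q) {κ : ℝ} (hκ : 0 < κ) (hκD : κ * diam Ω < Real.pi)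
    (hx : x ∈ Ω) (hy : y ∈ Ω) (hxy : x ≠ y) :
    gradGap (fun z => Real.log (φ z)) x y ≤ -(2 * κ * Real.tan (κ * (‖x - y‖ / 2))) := by
  set v := fun z => Real.log (φ z) with hv
  set G := fun z => Real.exp (-(3 / 4) * Real.log (φ z)) with hG
  set ψ : ℝ → ℝ := fun s => -(κ * Real.tan (κ * s)) with hψ
  set ψ' : ℝ → ℝ := fun s => -(κ ^ 2 * (1 + Real.tan (κ * s) ^ 2)) with hψ'
  have hIoo : ∀ s ∈ Icc 0 (diam Ω / 2), κ * s ∈ Ioo (-(Real.pi / 2)) (Real.pi / 2) := by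
    intro s hs
    have h1 : 0 ≤ κ * s := mul_nonneg hκ.le hs.1
    have h2 : κ * s ≤ κ * (diam Ω / 2) := by gcongr; exact hs.2
    constructor <;> linarith [Real.pi_pos]
  have hcos : ∀ s ∈ Icc 0 (diam Ω / 2), Real.cos (κ * s) ≠ 0 := fun s hs =>
    (Real.cos_pos_of_mem_Ioo (hIoo s hs)).ne'
  have hmemD : ∀ x ∈ Ω, ∀ y ∈ Ω, ‖x - y‖ / 2 ∈ Icc 0 (diam Ω / 2) := fun x hx y hy => by
    have := dist_le_diam_of_mem hbdd hx hy
    rw [dist_eq_norm] at this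
    exact ⟨by positivity, by linarith⟩
  have hd0 : (0 : ℝ) ∈ Icc 0 (diam Ω / 2) := 
    ⟨le_rfl, div_nonneg diam_nonneg zero_le_two⟩
  by_contra! hcon
  set m := gradGap v x y - 2 * ψ (‖x - y‖ / 2) with hm
  have hm0 : 0 < m := by rw [hm]; simp only [hψ]; linarith
  obtain ⟨CG, hCG, hdrift⟩ := h.exists_drift_lap_le hlap hq hΛ
  have hGpos : ∀ z, 0 < G z := fun z => Real.exp_pos _
  obtain ⟨ε, hε, hε1, hε2⟩ : ∃ ε > 0, ε * (G x + G y) ≤ m / 2 ∧ 2 * ε * CG < κ ^ 2 * m := by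
    have hGxy : 0 < G x + G y := add_pos (hGpos x) (hGpos y)
    refine ⟨min (m / 2 / (G x + G y)) (κ ^ 2 * m / (4 * CG)),
      lt_min (by positivity) (by positivity), ?_, ?_⟩
    · rw [← le_div_iff₀ hGxy]; exact min_le_left _ _
    · have h1 := min_le_right (m / 2 / (G x + G y)) (κ ^ 2 * m / (4 * CG))
      rw [le_div_iff₀ (by positivity)] at h1
      have h2 : 0 < κ ^ 2 * m := by positivity
      linarith
  obtain ⟨η, hη, δ, hδ, hsuper⟩ := h.exists_le_of_superlevel hbdd (ψ := ψ)
    (B := -(2 * ψ (diam Ω / 2))) (hasDerivAt_neg_mul_tan (hcos 0 hd0)).continuousAt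
    (by simp [hψ]) (by
      intro s hs
      have hDmem : diam Ω / 2 ∈ Icc 0 (diam Ω / 2) := ⟨hd0.2, le_rfl⟩
      have := Real.strictMonoOn_tan.monotoneOn (hIoo s hs) (hIoo _ hDmem)
        (mul_le_mul_of_nonneg_left hs.2 hκ.le)
      simp only [hψ]
      nlinarith) hε (half_pos hm0)
  set f : EuclideanSpace ℝ (Fin n) × EuclideanSpace ℝ (Fin n) → ℝ := fun p =>
    gradGap v p.1 p.2 - 2 * ψ (‖p.1 - p.2‖ / 2) - ε * (G p.1 + G p.2) with hf
  have hf0 : m / 2 ≤ f (x, y) := by simp only [hf]; linarith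
  set U : Set (EuclideanSpace ℝ (Fin n) × EuclideanSpace ℝ (Fin n)) :=
    (Ω ×ˢ Ω) ∩ {p | p.1 ≠ p.2} with hU
  have hUo : IsOpen U := (h.isOpen.prod h.isOpen).inter
    (isOpen_ne_fun continuous_fst continuous_snd)
  set T := closure Ω ∩ φ ⁻¹' Ici η with hT
  have hTc : IsCompact T := hbdd.isCompact_closure.of_isClosed_subset
    (h.continuousOn.preimage_isClosed_of_isClosed isClosed_closure isClosed_Ici) inter_subset_left
  have hTΩ : T ⊆ Ω := fun z hz => by
    by_contra hzΩ
    have h0 := h.eq_zero z ⟨hz.1, fun hi => hzΩ (interior_subset hi)⟩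
    have h1 : η ≤ φ z := hz.2
    linarith
  set S : Set (EuclideanSpace ℝ (Fin n) × EuclideanSpace ℝ (Fin n)) :=
    (T ×ˢ T) ∩ {p | δ ≤ ‖p.1 - p.2‖} with hS
  have hSc : IsCompact S := (hTc.prod hTc).inter_right (isClosed_le (by fun_prop) (by fun_prop))
  have hSU : S ⊆ U := fun p hp => by
    refine ⟨⟨hTΩ hp.1.1, hTΩ hp.1.2⟩, fun heq => ?_⟩
    have h1 : δ ≤ ‖p.1 - p.2‖ := hp.2
    rw [heq, sub_self, norm_zero] at h1
    linarith
  obtain ⟨⟨x₁, y₁⟩, ⟨⟨hx₁, hy₁⟩, hne₁⟩, hmax, hle⟩ := exists_isLocalMax_of_isCompact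
    (p₀ := (x, y)) hUo hSc hSU (f := f)
    (fun p hp => (h.continuousAt_penalized (hSU hp).1.1 (hSU hp).1.2 (hSU hp).2
      (hasDerivAt_neg_mul_tan (hcos _ (hmemD _ (hSU hp).1.1 _ (hSU hp).1.2))).continuousAt
      ).continuousWithinAt)
    ⟨⟨hx, hy⟩, hxy⟩
    (fun p hp hle => by
      obtain ⟨h1, h2, h3⟩ := hsuper p.1 hp.1.1 p.2 hp.1.2 hp.2 (hf0.trans hle)
      exact ⟨⟨⟨subset_closure hp.1.1, h1⟩, ⟨subset_closure hp.1.2, h2⟩⟩, h3⟩)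
  simp only at hx₁ hy₁
  have hne₂ : x₁ ≠ y₁ := hne₁
  obtain ⟨e, he, hxye⟩ := exists_unit_smul_eq_sub hne₂
  have hr : 0 < ‖x₁ - y₁‖ := norm_pos_iff.2 (sub_ne_zero.2 hne₂)
  have hrmem := hmemD x₁ hx₁ y₁ hy₁
  set r := ‖x₁ - y₁‖ with hrdef
  have hcosev : ∀ᶠ s in nhds (r / 2), Real.cos (κ * s) ≠ 0 :=
    (by fun_prop : Continuous fun s => Real.cos (κ * s)).continuousAt.eventually_ne (hcos _ hrmem)
  have hG2 : ∀ z ∈ Ω, ContDiffAt ℝ 2 G z := fun z hz =>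
    (contDiffAt_const.mul (h.contDiffAt_two_log hz)).exp
  have hmain := two_point_maximum_principle hr he hxye (h.contDiffAt_log hx₁)
    (h.contDiffAt_log hy₁) (hG2 x₁ hx₁) (hG2 y₁ hy₁)
    (hcosev.mono fun s hs => hasDerivAt_neg_mul_tan hs)
    (hasDerivAt_neg_mul_one_add_tan_sq (hcos _ hrmem)) hmax
  have hveq : ∀ z ∈ Ω, ∀ᶠ z' in nhds z, lap v z' = q z' - ‖gradient v z'‖ ^ 2 := fun z hz => by
    filter_upwards [h.isOpen.mem_nhds hz] with z' hz'
    exact lap_log (h.contDiffAt_two hz') (h.pos z' hz') (hlap z' hz')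
  rw [lap_fderiv_apply_add (h.contDiffAt_log hx₁) (hqd x₁ hx₁) (hveq x₁ hx₁),
    lap_fderiv_apply_add (h.contDiffAt_log hy₁) (hqd y₁ hy₁) (hveq y₁ hy₁)] at hmain
  have hconv := fderiv_le_fderiv_of_convexOn hqc hx₁ hy₁ (hqd x₁ hx₁) (hqd y₁ hy₁) hr hxye
  have hd1 := hdrift x₁ hx₁
  have hd2 := hdrift y₁ hy₁
  have hright : ε * ((lap G x₁ + 2 * fderiv ℝ G x₁ (gradient v x₁))
      + (lap G y₁ + 2 * fderiv ℝ G y₁ (gradient v y₁))) ≤ 2 * ε * CG := by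
    have : ε * ((lap G x₁ + 2 * fderiv ℝ G x₁ (gradient v x₁))
      + (lap G y₁ + 2 * fderiv ℝ G y₁ (gradient v y₁))) ≤ ε * (CG + CG) := by gcongr
    linarith
  have hgg : 2 * ψ (r / 2) + m / 2 ≤ gradGap v x₁ y₁ := by
    have h1 : m / 2 ≤ f (x₁, y₁) := hf0.trans hle
    simp only [hf] at h1
    have h2 : 0 < ε * (G x₁ + G y₁) := mul_pos hε (add_pos (hGpos _) (hGpos _))
    linarith
  simp only [hψ] at hgg
  set t := Real.tan (κ * (r / 2)) with ht
  have hP : 0 ≤ κ ^ 2 * (1 + t ^ 2) := by positivity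
  have h1 := mul_le_mul_of_nonneg_left hgg hP
  have h2 : κ ^ 2 * m ≤ κ ^ 2 * (1 + t ^ 2) * m := by
    have : 0 ≤ κ ^ 2 * t ^ 2 * m := by positivity
    linarith
  linarith

end LinearGrowth

end TwoPoint

section GroundState

variable {n : ℕ} {Ω : Set (EuclideanSpace ℝ (Fin n))}

/-- Distances in a bounded open set are strictly smaller than its diameter. -/
lemma IsOpen.norm_sub_lt_diam (hΩ : IsOpen Ω) (hbdd : Bornology.IsBounded Ω)
    {x y : EuclideanSpace ℝ (Fin n)} (hx : x ∈ Ω) (hy : y ∈ Ω) (hxy : x ≠ y) :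
    ‖x - y‖ < diam Ω := by
  obtain ⟨e, he, hxye⟩ := exists_unit_smul_eq_sub hxy
  obtain ⟨δ, hδ, hball⟩ := Metric.isOpen_iff.1 hΩ x hx
  have hmem : x + (δ / 2) • e ∈ Ω := hball (by
    rw [mem_ball, dist_eq_norm, add_sub_cancel_left, norm_smul, he,
      Real.norm_of_nonneg (by positivity)]
    linarith)
  have h := dist_le_diam_of_mem hbdd hmem hy
  rw [dist_eq_norm, add_sub_right_comm, hxye, ← add_smul, norm_smul, he,
    Real.norm_of_nonneg (by positivity)] at h
  linarith

/-- Positive Dirichlet solutions of `Δφ = qφ` which are smooth up to the boundary grow linearly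
away from it. -/
lemma exists_linearGrowth {φ q : EuclideanSpace ℝ (Fin n) → ℝ} {Λ : ℝ} (hΩ : IsOpen Ω)
    (hne : Ω.Nonempty) (hbdd : Bornology.IsBounded Ω) (hconv : Convex ℝ Ω)
    (hfr : (frontier Ω).Nonempty)
    (hsmooth : ∃ r₀ > 0, ContDiffOn ℝ (⊤ : ℕ∞) (fun x => infDist x (frontier Ω))
      {x ∈ closure Ω | infDist x (frontier Ω) ≤ r₀})
    (hφ : ContDiffOn ℝ (⊤ : ℕ∞) φ (closure Ω)) (hpos : ∀ x ∈ Ω, 0 < φ x)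
    (hzero : ∀ x ∈ frontier Ω, φ x = 0) (hlap : ∀ x ∈ Ω, lap φ x = q x * φ x)
    (hq : ∀ x ∈ Ω, |q x| ≤ Λ) (hΛ : 0 ≤ Λ) :
    ∃ c L K M, LinearGrowth Ω φ c L K M := by
  obtain ⟨r₀, hr₀, hdist⟩ := hsmooth
  obtain ⟨L, hL, K, hK, M, hM, hbounds⟩ := exists_fderiv_bounds hΩ hne hconv hbdd hφ
  have hat : ∀ x ∈ Ω, ContDiffAt ℝ 3 φ x := fun x hx =>
    (hφ.contDiffAt (Filter.mem_of_superset (hΩ.mem_nhds hx) subset_closure)).of_le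
      ENat.LEInfty.out
  obtain ⟨c, hc, hgrow⟩ := exists_mul_infDist_le (φ := φ) (Λ := Λ) (ρ := r₀ / 2) hΩ hbdd hfr
    hφ.continuousOn (fun x hx => (hat x hx).of_le (by norm_num)) hpos hΛ
    (fun x hx => by
      rw [hlap x hx]
      exact mul_le_mul_of_nonneg_right ((le_abs_self _).trans (hq x hx)) (hpos x hx).le)
    (by positivity)
    (fun x hx hxd => exists_interior_ball hΩ hfr (hdist.differentiableOn (by simp)) hx hxd)
  exact ⟨c, L, K, M, hΩ, hconv, hfr, hφ.continuousOn,
    hat, hpos, hzero, hc, hL, hK, hM, hgrow,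
    fun x hx => (hbounds x hx).1, fun x hx => (hbounds x hx).2.1, fun x hx => (hbounds x hx).2.2⟩

end GroundState

/-- **Modulus of log-concavity of the ground state.**  If `Ω ⊂ ℝⁿ` is a bounded strictly
convex open domain with smooth boundary, of diameter `D`, and `V` is a smooth convex
potential on `Ω̄`, then the ground state `φ₀` of `-Δ + V` with Dirichlet boundary condition
satisfies, for all distinct `x, y ∈ Ω`,
`⟨∇log φ₀(x) - ∇log φ₀(y), (x-y)/|x-y|⟩ ≤ -(2π/D) tan(π|x-y|/(2D))`. -/
theorem modulus_of_log_concavity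
    {n : ℕ} {Ω : Set (EuclideanSpace ℝ (Fin n))}
    (hΩopen : IsOpen Ω) (hΩne : Ω.Nonempty) (hΩbdd : Bornology.IsBounded Ω)
    (hΩconv : StrictConvex ℝ Ω)
    (hΩsmooth : ∃ r₀ > 0, ContDiffOn ℝ (⊤ : ℕ∞) (fun x => Metric.infDist x (frontier Ω))
      {x ∈ closure Ω | Metric.infDist x (frontier Ω) ≤ r₀})
    {V φ₀ : EuclideanSpace ℝ (Fin n) → ℝ} {lam₀ : ℝ}
    (hV : ContDiffOn ℝ (⊤ : ℕ∞) V (closure Ω)) (hVconv : ConvexOn ℝ (closure Ω) V)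
    (hφ₀smooth : ContDiffOn ℝ (⊤ : ℕ∞) φ₀ (closure Ω))
    (hφ₀pos : ∀ x ∈ Ω, 0 < φ₀ x)
    (hφ₀bd : ∀ x ∈ frontier Ω, φ₀ x = 0)
    (hφ₀eig : ∀ x ∈ Ω, -lap φ₀ x + V x * φ₀ x = lam₀ * φ₀ x) :
    ∀ x ∈ Ω, ∀ y ∈ Ω, x ≠ y →
      ⟪gradient (fun z => Real.log (φ₀ z)) x - gradient (fun z => Real.log (φ₀ z)) y,
          (‖x - y‖)⁻¹ • (x - y)⟫
        ≤ -(2 * Real.pi / Metric.diam Ω) *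
            Real.tan (Real.pi * ‖x - y‖ / (2 * Metric.diam Ω)) := by
  intro x hx y hy hxy
  have hconv : Convex ℝ Ω := hΩconv.convex
  have hfr : (frontier Ω).Nonempty := by
    have : Nontrivial (EuclideanSpace ℝ (Fin n)) := ⟨x, y, hxy⟩
    refine nonempty_frontier_iff.2 ⟨hΩne, fun h => ?_⟩
    exact NormedSpace.unbounded_univ ℝ (EuclideanSpace ℝ (Fin n)) (h ▸ hΩbdd)
  set q : EuclideanSpace ℝ (Fin n) → ℝ := fun z => V z - lam₀ with hq
  have hlap : ∀ z ∈ Ω, lap φ₀ z = q z * φ₀ z := fun z hz => by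
    have := hφ₀eig z hz
    simp only [hq]
    linarith
  obtain ⟨Λ, hΛ, hqΛ⟩ := exists_pos_norm_le hΩbdd
    (hV.continuousOn.sub (continuousOn_const (c := lam₀)))
  have hqΛ' : ∀ z ∈ Ω, |q z| ≤ Λ := fun z hz => hqΛ z (subset_closure hz)
  have hqd : ∀ z ∈ Ω, DifferentiableAt ℝ q z := fun z hz =>
    ((hV.contDiffAt (Filter.mem_of_superset (hΩopen.mem_nhds hz) subset_closure)).differentiableAt
      (by simp)).sub_const lam₀
  have hqc : ConvexOn ℝ Ω q :=
    ((hVconv.subset subset_closure hconv).add_const (-lam₀)).congr fun z _ => by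
      simp [hq, sub_eq_add_neg]
  obtain ⟨c, L, K, M, hgrowth⟩ := exists_linearGrowth hΩopen hΩne hΩbdd hconv hfr hΩsmooth
    hφ₀smooth hφ₀pos hφ₀bd hlap hqΛ' hΛ.le
  have hr : 0 < ‖x - y‖ := norm_pos_iff.2 (sub_ne_zero.2 hxy)
  have hrD : ‖x - y‖ < diam Ω := hΩopen.norm_sub_lt_diam hΩbdd hx hy hxy
  have hD : 0 < diam Ω := hr.trans hrD
  have hκ : 0 < Real.pi / diam Ω := div_pos Real.pi_pos hD
  have hcos : Real.cos (Real.pi / diam Ω * (‖x - y‖ / 2)) ≠ 0 := by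
    refine (Real.cos_pos_of_mem_Ioo ⟨?_, ?_⟩).ne'
    · have : 0 ≤ Real.pi / diam Ω * (‖x - y‖ / 2) := by positivity
      linarith [Real.pi_pos]
    · calc Real.pi / diam Ω * (‖x - y‖ / 2) < Real.pi / diam Ω * (diam Ω / 2) := by gcongr
        _ = Real.pi / 2 := by field_simp
  have hcont : ContinuousAt (fun κ : ℝ => -(2 * κ * Real.tan (κ * (‖x - y‖ / 2))))
      (Real.pi / diam Ω) := by
    have h1 : ContinuousAt (fun κ : ℝ => Real.tan (κ * (‖x - y‖ / 2))) (Real.pi / diam Ω) :=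
      ContinuousAt.comp (g := Real.tan) (Real.continuousAt_tan.2 hcos) (by fun_prop)
    exact ((by fun_prop : ContinuousAt (fun κ : ℝ => 2 * κ) (Real.pi / diam Ω)).mul h1).neg
  have hlim : gradGap (fun z => Real.log (φ₀ z)) x y
      ≤ -(2 * (Real.pi / diam Ω) * Real.tan (Real.pi / diam Ω * (‖x - y‖ / 2))) := by
    refine ge_of_tendsto (hcont.tendsto.mono_left (nhdsWithin_le_nhds (s := Iio (Real.pi / diam Ω)))) ?_
    filter_upwards [Ioo_mem_nhdsLT hκ] with κ hκ'
    exact hgrowth.gradGap_log_le hΩbdd hlap hqΛ' hΛ hqd hqc hκ'.1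
      ((lt_div_iff₀ hD).1 hκ'.2) hx hy hxy
  rw [gradGap_eq_inner]
  refine hlim.trans_eq ?_
  rw [show Real.pi / diam Ω * (‖x - y‖ / 2) = Real.pi * ‖x - y‖ / (2 * diam Ω) by field_simp]
  ring
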